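/- Fix an integer ν ≥ 2 and a real ε with 0 < ε ≤ 2. There exist constants γ > 0 and C₁, C₂ > 0 (depending only on ν and ε) such that for every prime p and every integer h with 3 ≤ h ≤ γ·p^{1/(ν²−1)}, the number of elements s ∈ F_p for which |K_ν(p,h,s) − ν!·h^ν| > h^{ν−ε/2}·exp(C₁·log h/log log h) is at most C₂·h^{1+ε}. -/

import Mathlib

namespace ShiftedProducts

open Polynomial

/-- The monic polynomial `∏ (X + xᵢ)`. -/
noncomputable def shiftPoly {n : ℕ} (x : Fin n → ℤ) : ℤ[X] := ∏ i, (X + C (x i))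

/-- The integer tuples of length `n` with entries in `[1, h]`. -/
noncomputable def box (n h : ℕ) : Finset (Fin n → ℤ) :=
  Fintype.piFinset fun _ => Finset.Icc 1 (h : ℤ)

lemma mem_box {n h : ℕ} {x : Fin n → ℤ} : x ∈ box n h ↔ ∀ i, 1 ≤ x i ∧ x i ≤ (h : ℤ) := by
  simp [box]

lemma eval₂_shiftPoly {n : ℕ} (x : Fin n → ℤ) {R : Type*} [CommRing R] (φ : ℤ →+* R) (z : R) :
    (shiftPoly x).eval₂ φ z = ∏ i, (z + φ (x i)) := by
  simp only [shiftPoly, eval₂_finsetProd, eval₂_add, eval₂_X, eval₂_C]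

lemma aeval_shiftPoly {n : ℕ} (x : Fin n → ℤ) {R : Type*} [CommRing R] (z : R) :
    aeval z (shiftPoly x) = ∏ i, (z + (x i : R)) := by
  simp [shiftPoly]

lemma eval_shiftPoly {n : ℕ} (x : Fin n → ℤ) (z : ℤ) :
    (shiftPoly x).eval z = ∏ i, (z + x i) := by
  simp [shiftPoly, eval_prod]

lemma monic_shiftPoly {n : ℕ} (x : Fin n → ℤ) : (shiftPoly x).Monic :=
  monic_prod_of_monic _ _ fun _ _ => monic_X_add_C _

lemma natDegree_shiftPoly {n : ℕ} (x : Fin n → ℤ) : (shiftPoly x).natDegree = n := by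
  rw [shiftPoly, natDegree_prod_of_monic _ _ fun _ _ => monic_X_add_C _]
  simp only [natDegree_X_add_C, Finset.sum_const, Finset.card_univ, Fintype.card_fin, smul_eq_mul,
    mul_one]

lemma natDegree_shiftPoly_sub_lt {n : ℕ} (hn : 1 ≤ n) (x y : Fin n → ℤ) :
    (shiftPoly x - shiftPoly y).natDegree ≤ n - 1 := by
  by_cases h0 : shiftPoly x - shiftPoly y = 0
  · simp [h0]
  have : (shiftPoly x - shiftPoly y).degree < (shiftPoly x).degree := by
    apply degree_sub_lt_left
    · rw [degree_eq_natDegree (monic_shiftPoly x).ne_zero,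
        degree_eq_natDegree (monic_shiftPoly y).ne_zero, natDegree_shiftPoly, natDegree_shiftPoly]
    · exact (monic_shiftPoly x).ne_zero
    · rw [(monic_shiftPoly x).leadingCoeff, (monic_shiftPoly y).leadingCoeff]
  have := natDegree_lt_natDegree h0 this
  rw [natDegree_shiftPoly] at this
  omega

lemma norm_prod_add_le {n : ℕ} {h : ℝ} (a : Fin n → ℂ) (z : ℂ)
    (ha : ∀ i, ‖a i‖ ≤ h) : ‖∏ i, (z + a i)‖ ≤ (‖z‖ + h) ^ n := by
  rw [norm_prod]
  calc ∏ i, ‖z + a i‖ ≤ ∏ _i : Fin n, (‖z‖ + h) :=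
        Finset.prod_le_prod (fun _ _ => norm_nonneg _)
          fun i _ => (norm_add_le _ _).trans (by gcongr; exact ha i)
    _ = _ := by simp

lemma norm_prod_sub_prod_le {n : ℕ} {h : ℝ} (hh : 0 ≤ h) (a b : Fin n → ℂ) (z : ℂ)
    (ha : ∀ i, ‖a i‖ ≤ h) (hb : ∀ i, ‖b i‖ ≤ h) (hab : ∀ i, ‖a i - b i‖ ≤ h) :
    ‖∏ i, (z + a i) - ∏ i, (z + b i)‖ ≤ n * h * (‖z‖ + h) ^ (n - 1) := by
  induction n with
  | zero => simp
  | succ n ih =>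
    rw [Fin.prod_univ_succ, Fin.prod_univ_succ]
    have h1 := ih (fun i => a i.succ) (fun i => b i.succ) (fun i => ha _) (fun i => hb _)
      (fun i => hab _)
    have h2 := norm_prod_add_le (fun i : Fin n => a i.succ) z (fun i => ha _)
    have e : (z + a 0) * ∏ i : Fin n, (z + a i.succ) - (z + b 0) * ∏ i : Fin n, (z + b i.succ)
        = (a 0 - b 0) * ∏ i : Fin n, (z + a i.succ) +
          (z + b 0) * (∏ i : Fin n, (z + a i.succ) - ∏ i : Fin n, (z + b i.succ)) := by ring
    rw [e]
    have h3 : ‖z + b 0‖ ≤ ‖z‖ + h := (norm_add_le _ _).trans (by gcongr; exact hb 0)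
    have hz : 0 ≤ ‖z‖ + h := by positivity
    calc _ ≤ ‖a 0 - b 0‖ * ‖∏ i : Fin n, (z + a i.succ)‖ + ‖z + b 0‖ *
            ‖∏ i : Fin n, (z + a i.succ) - ∏ i : Fin n, (z + b i.succ)‖ := by
          refine (norm_add_le _ _).trans ?_
          rw [norm_mul, norm_mul]
      _ ≤ h * (‖z‖ + h) ^ n + (‖z‖ + h) * (n * h * (‖z‖ + h) ^ (n - 1)) := by
          gcongr
          exact hab 0
      _ = _ := by
          rcases n with _ | m
          · simp
          · simp only [Nat.add_sub_cancel, Nat.cast_add, Nat.cast_one]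
            ring

/-- The Mahler measure of the rescaled polynomial `f(hX)`. -/
noncomputable def scaledMahler (h : ℕ) (f : ℤ[X]) : ℝ :=
  ((f.map (Int.castRingHom ℂ)).comp (C (h : ℂ) * X)).mahlerMeasure

lemma scaledMahler_mul (h : ℕ) (f g : ℤ[X]) :
    scaledMahler h (f * g) = scaledMahler h f * scaledMahler h g := by
  simp [scaledMahler, mahlerMeasure_mul]

lemma scaledMahler_eq {h : ℕ} (hh : 1 ≤ h) (f : ℤ[X]) :
    scaledMahler h f = |(f.leadingCoeff : ℝ)| *
      ((f.map (Int.castRingHom ℂ)).roots.map (fun α => max (h : ℝ) ‖α‖)).prod := by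
  have hinj : Function.Injective (Int.castRingHom ℂ) := RingHom.injective_int _
  have hs := IsAlgClosed.splits (f.map (Int.castRingHom ℂ))
  have e := hs.eq_prod_roots
  have h0 : (h : ℂ) ≠ 0 := by exact_mod_cast (by omega : h ≠ 0)
  unfold scaledMahler
  conv_lhs => rw [e]
  rw [mul_comp, C_comp, multiset_prod_comp, mahlerMeasure_mul, mahlerMeasure_const,
    prod_mahlerMeasure_eq_mahlerMeasure_prod]
  congr 1
  · rw [leadingCoeff_map_of_injective hinj]
    simp
  · rw [Multiset.map_map, Multiset.map_map]
    congr 1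
    apply Multiset.map_congr rfl
    intro α _
    have := mahlerMeasure_C_mul_X_add_C h0 (-α)
    simp only [Function.comp, sub_comp, X_comp, C_comp]
    rw [C_neg, ← sub_eq_add_neg] at this
    rw [this]
    simp

lemma one_le_scaledMahler {h : ℕ} (hh : 1 ≤ h) {f : ℤ[X]} (hf : f ≠ 0) :
    1 ≤ scaledMahler h f := by
  rw [scaledMahler_eq hh]
  have h1 : (1 : ℝ) ≤ |(f.leadingCoeff : ℝ)| := by
    have := Int.one_le_abs (leadingCoeff_ne_zero.2 hf)
    exact_mod_cast this
  refine one_le_mul_of_one_le_of_one_le h1 (Multiset.one_le_prod ?_)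
  simp only [Multiset.mem_map]
  rintro _ ⟨α, _, rfl⟩
  exact le_max_of_le_left (by exact_mod_cast hh)

lemma mahlerMeasure_le_of_forall_norm_eval_le {f : ℂ[X]} {B : ℝ} (hB : 1 ≤ B)
    (hf : ∀ z, ‖z‖ = 1 → ‖f.eval z‖ ≤ B) : f.mahlerMeasure ≤ B := by
  by_cases h0 : f = 0
  · simp [h0]; linarith
  rw [mahlerMeasure, if_pos h0, ← Real.le_log_iff_exp_le (by linarith), logMahlerMeasure_def]
  apply Real.circleAverage_mono_on_of_le_circle
  · exact f.intervalIntegrable_mahlerMeasure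
  · intro z hz
    have hz' : ‖z‖ = 1 := by simpa using hz
    by_cases h1 : ‖f.eval z‖ = 0
    · simp only [h1, Real.log_zero]; exact Real.log_nonneg hB
    · exact Real.log_le_log (lt_of_le_of_ne (norm_nonneg _) (Ne.symm h1)) (hf z hz')

lemma norm_intCast_le {n h : ℕ} {x : Fin n → ℤ} (hx : x ∈ box n h) (i : Fin n) :
    ‖(x i : ℂ)‖ ≤ h := by
  obtain ⟨h1, h2⟩ := mem_box.1 hx i
  rw [Complex.norm_intCast, abs_of_nonneg (by exact_mod_cast (by omega : (0 : ℤ) ≤ x i))]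
  exact_mod_cast h2

lemma scaledMahler_shiftPoly_sub_le {n h : ℕ} (hh : 1 ≤ h) {x y : Fin n → ℤ}
    (hx : x ∈ box n h) (hy : y ∈ box n h) :
    scaledMahler h (shiftPoly x - shiftPoly y) ≤ 2 * (2 * h) ^ n := by
  have hh' : (1 : ℝ) ≤ h := by exact_mod_cast hh
  apply mahlerMeasure_le_of_forall_norm_eval_le
  · have : (1 : ℝ) ≤ (2 * h) ^ n := one_le_pow₀ (by linarith)
    linarith
  intro z hz
  rw [eval_comp, eval_map, eval₂_sub, eval₂_shiftPoly, eval₂_shiftPoly]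
  refine (norm_sub_le _ _).trans ?_
  have := norm_prod_add_le (fun i => (x i : ℂ)) (h * z) (norm_intCast_le hx)
  have := norm_prod_add_le (fun i => (y i : ℂ)) (h * z) (norm_intCast_le hy)
  simp only [norm_mul, Complex.norm_natCast, hz, mul_one, ← two_mul] at *
  simp only [eval_mul, eval_C, eval_X, eq_intCast]
  linarith

lemma norm_aeval_shiftPoly_sub_le {n h : ℕ} {x y : Fin n → ℤ}
    (hx : x ∈ box n h) (hy : y ∈ box n h) (z : ℂ) :
    ‖aeval z (shiftPoly x - shiftPoly y)‖ ≤ n * h * (2 * max (h : ℝ) ‖z‖) ^ (n - 1) := by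
  rw [map_sub, aeval_shiftPoly, aeval_shiftPoly]
  refine (norm_prod_sub_prod_le (Nat.cast_nonneg h) _ _ z (norm_intCast_le hx)
    (norm_intCast_le hy) ?_).trans ?_
  · intro i
    obtain ⟨h1, h2⟩ := mem_box.1 hx i
    obtain ⟨h3, h4⟩ := mem_box.1 hy i
    rw [← Int.cast_sub, Complex.norm_intCast]
    have : |x i - y i| ≤ h := by rw [abs_le]; omega
    exact_mod_cast this
  · gcongr
    have := le_max_left (h : ℝ) ‖z‖
    have := le_max_right (h : ℝ) ‖z‖
    linarith

lemma dvd_of_common_complex_root {f g : ℤ[X]} (hf : Irreducible f) (hd : 1 ≤ f.natDegree)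
    {α : ℂ} (h1 : aeval α f = 0) (h2 : aeval α g = 0) : f ∣ g := by
  have hp : f.IsPrimitive := hf.isPrimitive (by omega)
  rw [IsPrimitive.Int.dvd_iff_map_cast_dvd_map_cast _ _ hp]
  have hi := (IsPrimitive.Int.irreducible_iff_irreducible_map_cast hp).1 hf
  refine (dvd_or_isCoprime _ (g.map (Int.castRingHom ℚ)) hi).resolve_right ?_
  rintro ⟨u, v, huv⟩
  have := congrArg (aeval α) huv
  have e : ∀ q : ℤ[X], aeval α (q.map (Int.castRingHom ℚ)) = aeval α q := fun q =>
    aeval_map_algebraMap ℚ α q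
  simp [e, h1, h2] at this

lemma exists_irreducible_dvd_aeval_eq_zero {R : Type*} [CommRing R] [IsDomain R] (s : R)
    {P : ℤ[X]} (hP : P ≠ 0) (hs : aeval s P = 0) : ∃ f, Irreducible f ∧ f ∣ P ∧ aeval s f = 0 := by
  induction P using WfDvdMonoid.induction_on_irreducible with
  | zero => exact absurd rfl hP
  | unit u hu => exact absurd hs (hu.map (aeval s)).ne_zero
  | mul a i ha hi ih =>
    rw [map_mul, mul_eq_zero] at hs
    rcases hs with hs | hs
    · exact ⟨i, hi, dvd_mul_right _ _, hs⟩
    · obtain ⟨f, h1, h2, h3⟩ := ih ha hs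
      exact ⟨f, h1, h2.mul_left _, h3⟩

lemma prime_dvd_resultant {p : ℕ} {f g : ℤ[X]} {m : ℕ} (hd : 1 ≤ f.natDegree)
    (hg : g.natDegree ≤ m) {s : ZMod p} (h1 : aeval s f = 0) (h2 : aeval s g = 0) :
    (p : ℤ) ∣ resultant f g f.natDegree m := by
  obtain ⟨u, v, _, _, e⟩ := exists_mul_add_mul_eq_C_resultant f g le_rfl hg (by omega)
  have := congrArg (aeval s) e
  rw [map_add, map_mul, map_mul, h1, h2, zero_mul, zero_mul, add_zero, aeval_C] at this
  rw [← ZMod.intCast_zmod_eq_zero_iff_dvd]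
  simpa using this.symm

lemma intCast_resultant_eq {f g : ℤ[X]} {m : ℕ} (hg : g.natDegree ≤ m) :
    ((resultant f g f.natDegree m : ℤ) : ℂ) = (f.leadingCoeff : ℂ) ^ m *
      ((f.map (Int.castRingHom ℂ)).roots.map (fun α => aeval α g)).prod := by
  have hinj : Function.Injective (Int.castRingHom ℂ) := RingHom.injective_int _
  have := resultant_eq_prod_eval (f.map (Int.castRingHom ℂ)) (g.map (Int.castRingHom ℂ)) m
    (natDegree_map_le.trans hg) (IsAlgClosed.splits _)
  rw [natDegree_map_eq_of_injective hinj, resultant_map_map,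
    leadingCoeff_map_of_injective hinj] at this
  simp only [eq_intCast] at this
  rw [this]
  congr 3
  ext α
  simp [eval_map, aeval_def]

/-- For `p` large against a power of `h`, all polynomials `∏ (X + xᵢ) - ∏ (X + yᵢ)` vanishing
at `s` modulo `p` have a common irreducible factor that vanishes at `s`. -/
theorem exists_irreducible_common_factor {n h p : ℕ} (hn : 2 ≤ n) (hh : 1 ≤ h) (hp : p.Prime)
    (hlt : (n * 4 ^ n * h ^ (n + 1)) ^ (n - 1) < p) (s : ZMod p) {x₀ y₀ : Fin n → ℤ}
    (hx₀ : x₀ ∈ box n h) (hy₀ : y₀ ∈ box n h) (hne : shiftPoly x₀ ≠ shiftPoly y₀)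
    (h₀ : aeval s (shiftPoly x₀) = aeval s (shiftPoly y₀)) :
    ∃ f : ℤ[X], Irreducible f ∧ 1 ≤ f.natDegree ∧ aeval s f = 0 ∧
      ∀ x ∈ box n h, ∀ y ∈ box n h, aeval s (shiftPoly x) = aeval s (shiftPoly y) →
        f ∣ shiftPoly x - shiftPoly y := by
  have := Fact.mk hp
  have hh' : (1 : ℝ) ≤ h := by exact_mod_cast hh
  obtain ⟨f, hf, ⟨R, hR⟩, hfs⟩ := exists_irreducible_dvd_aeval_eq_zero s (sub_ne_zero.2 hne)
    (by rw [map_sub, h₀, sub_self])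
  have hR0 : R ≠ 0 := by
    rintro rfl
    exact sub_ne_zero.2 hne (by rw [hR, mul_zero])
  have hM : scaledMahler h f ≤ 2 * (2 * h) ^ n := by
    have h1 := scaledMahler_shiftPoly_sub_le hh hx₀ hy₀
    rw [hR, scaledMahler_mul] at h1
    have h2 := one_le_scaledMahler hh hR0
    have h3 := one_le_scaledMahler hh hf.ne_zero
    nlinarith
  have hlt' : ((n * 4 ^ n * h ^ (n + 1) : ℝ)) ^ (n - 1) < p := by exact_mod_cast hlt
  have hn' : (2 : ℝ) ≤ n := by exact_mod_cast hn
  have h4 : (1 : ℝ) ≤ n * 4 ^ n * h ^ (n + 1) := by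
    have : (1 : ℝ) ≤ 4 ^ n := one_le_pow₀ (by norm_num)
    have : (1 : ℝ) ≤ h ^ (n + 1) := one_le_pow₀ hh'
    exact one_le_mul_of_one_le_of_one_le (one_le_mul_of_one_le_of_one_le (by linarith) ‹_›) ‹_›
  have hd : 1 ≤ f.natDegree := by
    by_contra hcon
    obtain ⟨c, rfl⟩ : ∃ c, f = C c := ⟨_, eq_C_of_natDegree_eq_zero (by omega)⟩
    rw [aeval_C] at hfs
    have hpc : (p : ℤ) ∣ c := by
      rw [← ZMod.intCast_zmod_eq_zero_iff_dvd]
      simpa using hfs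
    have hc0 : c ≠ 0 := by rintro rfl; simp at hf
    have hpc' : (p : ℝ) ≤ |(c : ℝ)| := by
      have := Int.le_of_dvd (abs_pos.2 hc0) ((dvd_abs _ _).2 hpc)
      exact_mod_cast this
    rw [scaledMahler_eq hh] at hM
    rw [leadingCoeff_C, Polynomial.map_C, roots_C, Multiset.map_zero, Multiset.prod_zero,
      mul_one] at hM
    have h5 : (2 * (2 * h) ^ n : ℝ) ≤ n * 4 ^ n * h ^ (n + 1) := by
      rw [mul_pow]
      have : (2 : ℝ) ^ n ≤ 4 ^ n := by gcongr; norm_num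
      have : (h : ℝ) ^ n ≤ h ^ (n + 1) := pow_le_pow_right₀ hh' (by omega)
      rw [← mul_assoc]
      gcongr
    have h6 := le_self_pow₀ h4 (by omega : n - 1 ≠ 0)
    linarith
  refine ⟨f, hf, hd, hfs, fun x hx y hy hxy => ?_⟩
  set g := shiftPoly x - shiftPoly y with hgdef
  have hg : g.natDegree ≤ n - 1 := natDegree_shiftPoly_sub_lt (by omega) x y
  have hdvd := prime_dvd_resultant hd hg hfs (by rw [hgdef, map_sub, hxy, sub_self])
  have hres := intCast_resultant_eq (f := f) hg
  have hroots : (f.map (Int.castRingHom ℂ)).roots.card ≤ n - 1 := by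
    refine (card_roots' _).trans (natDegree_map_le.trans ?_)
    refine le_trans ?_ (natDegree_shiftPoly_sub_lt (by omega) x₀ y₀)
    exact natDegree_le_of_dvd ⟨R, hR⟩ (sub_ne_zero.2 hne)
  have hbound : ‖((resultant f g f.natDegree (n - 1) : ℤ) : ℂ)‖ < p := by
    rw [hres, norm_mul, norm_pow]
    set ρ := (f.map (Int.castRingHom ℂ)).roots
    have e1 : ‖(ρ.map (fun α => aeval α g)).prod‖ ≤
        (ρ.map (fun α => n * h * (2 * max (h : ℝ) ‖α‖) ^ (n - 1))).prod := by
      have : ‖(ρ.map (fun α => aeval α g)).prod‖ = (ρ.map (fun α => ‖aeval α g‖)).prod := by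
        have := map_multiset_prod (normHom : ℂ →*₀ ℝ) (ρ.map (fun α => aeval α g))
        rwa [Multiset.map_map] at this
      rw [this]
      apply Multiset.prod_map_le_prod_map₀
      · intro i _; exact norm_nonneg _
      · intro α _; exact norm_aeval_shiftPoly_sub_le hx hy α
    have e2 : (ρ.map (fun α => n * h * (2 * max (h : ℝ) ‖α‖) ^ (n - 1))).prod =
        (n * h * 2 ^ (n - 1)) ^ ρ.card * (ρ.map (fun α => max (h : ℝ) ‖α‖)).prod ^ (n - 1) := by
      simp only [mul_pow, ← mul_assoc, Multiset.prod_map_mul, Multiset.map_const',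
        Multiset.prod_replicate, Multiset.prod_map_pow]
    have e3 : ((n : ℝ) * h * 2 ^ (n - 1)) ^ ρ.card ≤ (n * h * 2 ^ (n - 1)) ^ (n - 1) := by
      apply pow_le_pow_right₀ _ hroots
      exact one_le_mul_of_one_le_of_one_le (one_le_mul_of_one_le_of_one_le (by linarith) hh')
        (one_le_pow₀ (by norm_num))
    have hprod : 0 ≤ (ρ.map (fun α => max (h : ℝ) ‖α‖)).prod := by
      apply Multiset.prod_nonneg
      simp only [Multiset.mem_map]
      rintro _ ⟨α, _, rfl⟩
      positivity
    calc ‖(f.leadingCoeff : ℂ)‖ ^ (n - 1) * ‖(ρ.map (fun α => aeval α g)).prod‖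
        ≤ ‖(f.leadingCoeff : ℂ)‖ ^ (n - 1) * ((n * h * 2 ^ (n - 1)) ^ (n - 1) *
          (ρ.map (fun α => max (h : ℝ) ‖α‖)).prod ^ (n - 1)) := by
          gcongr
          rw [e2] at e1
          refine e1.trans ?_
          gcongr
      _ = (n * h * 2 ^ (n - 1) * scaledMahler h f) ^ (n - 1) := by
          rw [scaledMahler_eq hh, Complex.norm_intCast]
          simp only [mul_pow]
          ring
      _ ≤ (n * h * 2 ^ (n - 1) * (2 * (2 * h) ^ n)) ^ (n - 1) := by
          gcongr
          have := one_le_scaledMahler hh hf.ne_zero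
          positivity
      _ = (n * 4 ^ n * h ^ (n + 1)) ^ (n - 1) := by
          congr 1
          obtain ⟨k, rfl⟩ : ∃ k, n = k + 1 := ⟨n - 1, by omega⟩
          rw [show (4 : ℝ) = 2 * 2 by norm_num]
          simp only [Nat.add_sub_cancel, mul_pow]
          ring
      _ < p := hlt'
  have hzero : resultant f g f.natDegree (n - 1) = 0 := by
    by_contra hne0
    have := Int.le_of_dvd (abs_pos.2 hne0) ((dvd_abs _ _).2 hdvd)
    rw [Complex.norm_intCast] at hbound
    have h7 : (p : ℝ) ≤ |((resultant f g f.natDegree (n - 1) : ℤ) : ℝ)| := by exact_mod_cast this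
    linarith
  rw [hzero, Int.cast_zero, eq_comm, mul_eq_zero] at hres
  have hl : (f.leadingCoeff : ℂ) ≠ 0 := by
    exact_mod_cast leadingCoeff_ne_zero.2 hf.ne_zero
  have := hres.resolve_left (pow_ne_zero _ hl)
  rw [Multiset.prod_eq_zero_iff, Multiset.mem_map] at this
  obtain ⟨α, hα, hα'⟩ := this
  refine dvd_of_common_complex_root hf hd (α := α) ?_ hα'
  have := isRoot_of_mem_roots hα
  rw [IsRoot, eval_map] at this
  simpa [aeval_def] using this

/-- If `f` divides `∏ (X + xᵢ) - ∏ (X + yᵢ)`, then `f` has equal products over `-xᵢ` and `-yᵢ`. -/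
lemma prod_eval_neg_eq {n : ℕ} {f : ℤ[X]} {x y : Fin n → ℤ}
    (hf : f ∣ shiftPoly x - shiftPoly y) : ∏ i, f.eval (-x i) = ∏ i, f.eval (-y i) := by
  have key : ∀ z : Fin n → ℤ, f.resultant (shiftPoly z) f.natDegree n =
      (-1) ^ (f.natDegree * n) * ∏ i, f.eval (-z i) := by
    intro z
    have h1 := resultant_prod_right Finset.univ f (fun i => X + C (z i)) f.natDegree le_rfl
      (by simp only [leadingCoeff_X_add_C]; simp)
    have h2 : (∏ i, (X + C (z i))).natDegree = n := natDegree_shiftPoly z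
    rw [h2] at h1
    rw [shiftPoly, h1]
    simp only [natDegree_X_add_C, resultant_X_add_C_right f f.natDegree _ le_rfl]
    rw [Finset.prod_mul_distrib]
    simp [pow_mul]
  obtain ⟨p, hp⟩ := hf
  rcases eq_or_ne (shiftPoly x) (shiftPoly y) with h0 | h0
  · have := (key x).symm.trans ((congrArg (fun g => f.resultant g f.natDegree n) h0).trans (key y))
    exact mul_left_cancel₀ (pow_ne_zero _ (by norm_num)) this
  · have hfp : f * p ≠ 0 := by rw [← hp]; exact sub_ne_zero.2 h0
    have hdeg : p.natDegree + f.natDegree ≤ n := by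
      rw [add_comm, ← natDegree_mul (left_ne_zero_of_mul hfp) (right_ne_zero_of_mul hfp), ← hp]
      refine (natDegree_sub_le _ _).trans ?_
      rw [natDegree_shiftPoly, natDegree_shiftPoly, max_self]
    have h1 := resultant_add_mul_right f (shiftPoly y) p f.natDegree n hdeg le_rfl
    rw [← hp, add_sub_cancel, key, key] at h1
    exact mul_left_cancel₀ (pow_ne_zero _ (by norm_num)) h1

lemma eval_neg_dvd_prod_sub {n : ℕ} {f : ℤ[X]} {x y : Fin n → ℤ}
    (hf : f ∣ shiftPoly x - shiftPoly y) (j : Fin n) : f.eval (-y j) ∣ ∏ i, (x i - y j) := by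
  have h1 := eval_dvd (x := -y j) hf
  have h0 : ∏ i, (-y j + y i) = 0 := Finset.prod_eq_zero (Finset.mem_univ j) (by ring)
  rw [eval_sub, eval_shiftPoly, eval_shiftPoly, h0, sub_zero] at h1
  simpa [neg_add_eq_sub] using h1

lemma exists_factorization_of_dvd_prod {n m : ℕ} (d : Fin n → ℕ) (hm : m ∣ ∏ i, d i) :
    ∃ g : Fin n → ℕ, ∏ i, g i = m ∧ ∀ i, g i ∣ d i := by
  induction n generalizing m with
  | zero => exact ⟨fun _ => 1, (Nat.dvd_one.1 (by simpa using hm)).symm, fun i => i.elim0⟩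
  | succ n ih =>
    rw [Fin.prod_univ_succ] at hm
    obtain ⟨a, b, ha, hb, rfl⟩ := exists_dvd_and_dvd_of_dvd_mul hm
    obtain ⟨g, hg, hgd⟩ := ih (fun i => d i.succ) hb
    refine ⟨Fin.cons a g, by rw [Fin.prod_univ_succ]; simp [hg], fun i => ?_⟩
    refine Fin.cases ?_ (fun i => ?_) i
    · simpa using ha
    · simpa using hgd i

/-- Tuples avoiding `y` for which a fixed integer divides the product of the differences with `y`
are counted through the factorizations of that integer. -/
lemma card_dvd_prod_sub_le {n m : ℕ} (hm : m ≠ 0) (A : Finset ℤ) (y : ℤ) {B : ℝ} (hB : 0 ≤ B)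
    (hA : ∀ g : Fin n → ℕ, ∏ i, g i = m → (∀ i, ∃ x ∈ A, x ≠ y ∧ (g i : ℤ) ∣ x - y) →
      ∏ i, ((A.filter fun x => x ≠ y ∧ (g i : ℤ) ∣ x - y).card : ℝ) ≤ B) :
    (((Fintype.piFinset fun _ : Fin n => A).filter fun x =>
      (∀ i, x i ≠ y) ∧ (m : ℤ) ∣ ∏ i, (x i - y)).card : ℝ) ≤ (m.divisors.card : ℝ) ^ n * B := by
  classical
  set G : Finset (Fin n → ℕ) :=
    (Fintype.piFinset fun _ : Fin n => m.divisors).filter fun g => ∏ i, g i = m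
  have hsub : ((Fintype.piFinset fun _ : Fin n => A).filter fun x =>
      (∀ i, x i ≠ y) ∧ (m : ℤ) ∣ ∏ i, (x i - y)) ⊆ G.biUnion fun g =>
        Fintype.piFinset fun i => A.filter fun x => x ≠ y ∧ (g i : ℤ) ∣ x - y := by
    intro x hx
    simp only [Finset.mem_filter, Fintype.mem_piFinset] at hx
    obtain ⟨hxA, hxy, hdvd⟩ := hx
    have : m ∣ ∏ i, (x i - y).natAbs := by
      have := Int.natAbs_dvd_natAbs.2 hdvd
      rwa [Int.natAbs_natCast, ← Int.natAbsHom_apply, map_prod] at this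
    obtain ⟨g, hg, hgd⟩ := exists_factorization_of_dvd_prod _ this
    simp only [Finset.mem_biUnion, Fintype.mem_piFinset, Finset.mem_filter, G]
    refine ⟨g, ⟨fun i => ?_, hg⟩, fun i => ⟨hxA i, hxy i, Int.natCast_dvd.2 (hgd i)⟩⟩
    rw [Nat.mem_divisors]
    exact ⟨hg ▸ Finset.dvd_prod_of_mem g (Finset.mem_univ i), hm⟩
  have hG : (G.card : ℝ) ≤ (m.divisors.card : ℝ) ^ n := by
    have := Finset.card_filter_le (Fintype.piFinset fun _ : Fin n => m.divisors)
      fun g => ∏ i, g i = m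
    rw [Fintype.card_piFinset] at this
    simp only [Finset.prod_const, Finset.card_univ, Fintype.card_fin] at this
    exact_mod_cast this
  calc _ ≤ ((G.biUnion fun g => Fintype.piFinset fun i =>
          A.filter fun x => x ≠ y ∧ (g i : ℤ) ∣ x - y).card : ℝ) := by
        exact_mod_cast Finset.card_le_card hsub
    _ ≤ ∑ g ∈ G, ((Fintype.piFinset fun i =>
          A.filter fun x => x ≠ y ∧ (g i : ℤ) ∣ x - y).card : ℝ) := by
        exact_mod_cast Finset.card_biUnion_le
    _ ≤ ∑ _g ∈ G, B := by
        apply Finset.sum_le_sum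
        intro g hg
        rw [Fintype.card_piFinset]
        push_cast
        by_cases hne : ∀ i, ∃ x ∈ A, x ≠ y ∧ (g i : ℤ) ∣ x - y
        · exact hA g (Finset.mem_filter.1 hg).2 hne
        · push Not at hne
          obtain ⟨i, hi⟩ := hne
          rw [Finset.prod_eq_zero (Finset.mem_univ i)]
          · exact hB
          · rw [Nat.cast_eq_zero, Finset.card_eq_zero, Finset.filter_eq_empty_iff]
            intro x hx hcon
            exact hi x hx hcon.1 hcon.2
    _ = G.card * B := by simp
    _ ≤ _ := by gcongr

lemma card_le_of_dvd_sub {S : Finset ℤ} {g : ℕ} (hg : 1 ≤ g) {L : ℝ} (hL : 0 ≤ L)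
    (hS : ∀ x ∈ S, ∀ y ∈ S, ((x - y : ℤ) : ℝ) ≤ L ∧ (g : ℤ) ∣ x - y) :
    (S.card : ℝ) ≤ L / g + 1 := by
  have hg0 : (0 : ℝ) < g := by exact_mod_cast hg
  rcases S.eq_empty_or_nonempty with rfl | hne
  · simp; positivity
  set a := S.min' hne
  have hmaps : Set.MapsTo (fun x => (x - a) / (g : ℤ)) S (Finset.Icc (0 : ℤ) ⌊L / g⌋) := by
    intro x hx
    simp only [Finset.coe_Icc, Set.mem_Icc]
    refine ⟨Int.ediv_nonneg (by have := S.min'_le x hx; omega) (by omega), ?_⟩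
    obtain ⟨h1, k, hk⟩ := hS x hx a (S.min'_mem hne)
    rw [hk, Int.mul_ediv_cancel_left _ (by omega), Int.le_floor, le_div_iff₀ hg0]
    rw [hk] at h1
    push_cast at h1
    linarith
  have hinj : Set.InjOn (fun x => (x - a) / (g : ℤ)) S := by
    intro x hx y hy hxy
    obtain ⟨_, k, hk⟩ := hS x hx a (S.min'_mem hne)
    obtain ⟨_, l, hl⟩ := hS y hy a (S.min'_mem hne)
    simp only [hk, hl] at hxy
    rw [Int.mul_ediv_cancel_left _ (by omega), Int.mul_ediv_cancel_left _ (by omega)] at hxy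
    rw [hxy] at hk
    omega
  have := Finset.card_le_card_of_injOn _ hmaps hinj
  rw [Int.card_Icc] at this
  have hfl : (0 : ℤ) ≤ ⌊L / g⌋ := Int.floor_nonneg.2 (by positivity)
  have h2 : (S.card : ℤ) ≤ ⌊L / g⌋ + 1 := by omega
  have h3 : (S.card : ℝ) ≤ ⌊L / g⌋ + 1 := by exact_mod_cast h2
  linarith [Int.floor_le (L / g)]

lemma card_filter_dvd_sub_le {h g : ℕ} (hg : 1 ≤ g) {y : ℤ} (hy : y ∈ Finset.Icc 1 (h : ℤ)) :
    (((Finset.Icc 1 (h : ℤ)).filter fun x => x ≠ y ∧ (g : ℤ) ∣ x - y).card : ℝ) ≤ h / g := by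
  classical
  have hg0 : (0 : ℝ) < g := by exact_mod_cast hg
  have hy' := Finset.mem_Icc.1 hy
  set S := (Finset.Icc 1 (h : ℤ)).filter fun x => x ≠ y ∧ (g : ℤ) ∣ x - y with hS
  have hyS : y ∉ S := by simp [hS]
  have := card_le_of_dvd_sub (S := insert y S) hg (L := h) (by positivity) (by
    have aux : ∀ x ∈ insert y S, (1 ≤ x ∧ x ≤ h) ∧ (g : ℤ) ∣ x - y := by
      intro x hx
      rcases Finset.mem_insert.1 hx with rfl | hx
      · simp [hy']
      · have := Finset.mem_filter.1 hx
        exact ⟨Finset.mem_Icc.1 this.1, this.2.2⟩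
    intro a ha b hb
    obtain ⟨h1, h2⟩ := aux a ha
    obtain ⟨h3, h4⟩ := aux b hb
    refine ⟨?_, by simpa using dvd_sub h2 h4⟩
    have : a - b ≤ (h : ℤ) := by omega
    exact_mod_cast this)
  rw [Finset.card_insert_of_notMem hyS] at this
  push_cast at this
  linarith

/-- A nonzero integer with at most `D` positive divisors is a product of values of `f` at
few tuples. -/
lemma card_prod_eval_neg_eq_le {n h D : ℕ} {f : ℤ[X]} (hf : 1 ≤ f.natDegree) {N : ℤ} (hN : N ≠ 0)
    (hD : N.natAbs.divisors.card ≤ D) :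
    ((box n h).filter fun y => ∏ i, f.eval (-y i) = N).card ≤ (2 * D * f.natDegree) ^ n := by
  classical
  set W : Finset ℤ := N.natAbs.divisors.image (fun k : ℕ => (k : ℤ)) ∪
    N.natAbs.divisors.image (fun k : ℕ => -(k : ℤ)) with hW
  have hWc : W.card ≤ 2 * D := by
    refine (Finset.card_union_le _ _).trans ?_
    have h1 := Finset.card_image_le (s := N.natAbs.divisors) (f := fun k : ℕ => (k : ℤ))
    have h2 := Finset.card_image_le (s := N.natAbs.divisors) (f := fun k : ℕ => -(k : ℤ))
    omega
  set V : Finset ℤ := (Finset.Icc 1 (h : ℤ)).filter fun y => f.eval (-y) ∣ N with hV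
  have hVc : V.card ≤ 2 * D * f.natDegree := by
    have := Finset.card_le_mul_card_image_of_maps_to (s := V) (t := W) (f := fun y => f.eval (-y))
      (by
        intro y hy
        have hy' := (Finset.mem_filter.1 hy).2
        have h1 : (f.eval (-y)).natAbs ∈ N.natAbs.divisors :=
          Nat.mem_divisors.2 ⟨Int.natAbs_dvd_natAbs.2 hy', by simpa using hN⟩
        rw [hW, Finset.mem_union, Finset.mem_image, Finset.mem_image]
        rcases Int.natAbs_eq (f.eval (-y)) with h2 | h2
        · exact Or.inl ⟨_, h1, h2.symm⟩
        · exact Or.inr ⟨_, h1, h2.symm⟩) f.natDegree (by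
        intro w _
        have hne : f - C w ≠ 0 := by
          intro h0
          rw [sub_eq_zero.1 h0, natDegree_C] at hf
          omega
        calc _ ≤ (f - C w).roots.toFinset.card := by
              apply Finset.card_le_card_of_injOn (fun y => -y)
              · intro y hy
                simp only [Finset.mem_coe, Multiset.mem_toFinset, mem_roots hne, IsRoot,
                  eval_sub, eval_C]
                rw [(Finset.mem_filter.1 hy).2, sub_self]
              · intro a _ b _ hab
                simpa using hab
          _ ≤ _ := (Multiset.toFinset_card_le _).trans
              ((card_roots' _).trans natDegree_sub_C.le)
        )
    calc V.card ≤ f.natDegree * W.card := this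
      _ ≤ f.natDegree * (2 * D) := by gcongr
      _ = _ := by ring
  calc _ ≤ (Fintype.piFinset fun _ : Fin n => V).card := by
        apply Finset.card_le_card
        intro y hy
        rw [Finset.mem_filter, mem_box] at hy
        rw [Fintype.mem_piFinset]
        intro i
        rw [hV, Finset.mem_filter, Finset.mem_Icc]
        exact ⟨hy.1 i, hy.2 ▸ Finset.dvd_prod_of_mem (fun i => f.eval (-y i)) (Finset.mem_univ i)⟩
    _ = V.card ^ n := by simp [Fintype.card_piFinset]
    _ ≤ _ := by gcongr

open Classical in
/-- Pairs of tuples in the box without common entries for which `f` divides the difference of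
the associated polynomials. -/
noncomputable def freeSet (f : ℤ[X]) (n h : ℕ) : Finset ((Fin n → ℤ) × (Fin n → ℤ)) :=
  (box n h ×ˢ box n h).filter fun xy =>
    f ∣ shiftPoly xy.1 - shiftPoly xy.2 ∧ ∀ i j, xy.1 i ≠ xy.2 j

lemma mem_freeSet {f : ℤ[X]} {n h : ℕ} {x y : Fin n → ℤ} : (x, y) ∈ freeSet f n h ↔
    x ∈ box n h ∧ y ∈ box n h ∧ f ∣ shiftPoly x - shiftPoly y ∧ ∀ i j, x i ≠ y j := by
  simp [freeSet, and_assoc]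

lemma swap_mem_freeSet {f : ℤ[X]} {n h : ℕ} {x y : Fin n → ℤ} (hxy : (x, y) ∈ freeSet f n h) :
    (y, x) ∈ freeSet f n h := by
  rw [mem_freeSet] at hxy ⊢
  exact ⟨hxy.2.1, hxy.1, (dvd_sub_comm).1 hxy.2.2.1, fun i j => (hxy.2.2.2 j i).symm⟩

lemma eval_neg_of_mem_freeSet {f : ℤ[X]} {n h : ℕ} {x y : Fin n → ℤ}
    (hxy : (x, y) ∈ freeSet f n h) (j : Fin n) :
    f.eval (-y j) ≠ 0 ∧ (f.eval (-y j)).natAbs ≤ h ^ n := by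
  rw [mem_freeSet] at hxy
  obtain ⟨hx, hy, hf, hne⟩ := hxy
  have h1 := eval_neg_dvd_prod_sub hf j
  have h2 : ∏ i, (x i - y j) ≠ 0 := Finset.prod_ne_zero_iff.2 fun i _ => sub_ne_zero.2 (hne i j)
  refine ⟨fun h0 => h2 (by simpa [h0] using h1), ?_⟩
  refine (Nat.le_of_dvd (Int.natAbs_pos.2 h2) (Int.natAbs_dvd_natAbs.2 h1)).trans ?_
  rw [← Int.natAbsHom_apply, map_prod]
  refine (Finset.prod_le_pow_card _ _ h fun i _ => ?_).trans (by simp)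
  have := mem_box.1 hx i
  have := mem_box.1 hy j
  rw [Int.natAbsHom_apply]
  omega

/-- For pairs in `freeSet`, the first component determines the second up to few choices. -/
lemma card_le_mul_card_image_fst {f : ℤ[X]} {n h D : ℕ} (hf : 1 ≤ f.natDegree)
    (hD : ∀ m : ℕ, m ≠ 0 → m ≤ h ^ (n ^ 2) → m.divisors.card ≤ D)
    {S : Finset ((Fin n → ℤ) × (Fin n → ℤ))} (hS : S ⊆ freeSet f n h) :
    S.card ≤ (2 * D * f.natDegree) ^ n * (S.image Prod.fst).card := by
  classical
  refine Finset.card_le_mul_card_image S _ fun x hx => ?_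
  obtain ⟨⟨x', y⟩, hxy, rfl⟩ := Finset.mem_image.1 hx
  have hN0 : ∏ i, f.eval (-x' i) ≠ 0 := Finset.prod_ne_zero_iff.2 fun i _ =>
    (eval_neg_of_mem_freeSet (swap_mem_freeSet (hS hxy)) i).1
  have hN1 : (∏ i, f.eval (-x' i)).natAbs ≤ h ^ (n ^ 2) := by
    rw [← Int.natAbsHom_apply, map_prod, sq, pow_mul]
    refine (Finset.prod_le_pow_card _ _ (h ^ n) fun i _ => ?_).trans (by simp)
    exact (eval_neg_of_mem_freeSet (swap_mem_freeSet (hS hxy)) i).2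
  refine le_trans ?_ (card_prod_eval_neg_eq_le (h := h) hf hN0 (hD _ (by simpa using hN0) hN1))
  apply Finset.card_le_card_of_injOn Prod.snd
  · rintro ⟨a, b⟩ hab
    obtain ⟨hab1, hab2⟩ := Finset.mem_filter.1 hab
    dsimp only at hab2
    subst hab2
    have := mem_freeSet.1 (hS hab1)
    exact Finset.mem_filter.2 ⟨this.2.1, (prod_eval_neg_eq this.2.2.1).symm⟩
  · rintro ⟨a, b⟩ hab ⟨c, d⟩ hcd hbd
    have h1 := (Finset.mem_filter.1 hab).2
    have h2 := (Finset.mem_filter.1 hcd).2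
    dsimp only at h1 h2 hbd
    rw [h1, h2, hbd]

lemma card_image_swap_freeSet {n : ℕ} (S : Finset ((Fin n → ℤ) × (Fin n → ℤ))) :
    (S.image Prod.swap).card = S.card :=
  Finset.card_image_of_injective _ Prod.swap_injective

/-- Pairs in `freeSet` whose second component has `j`-th entry `t` and whose first component has
its entries in a set depending on `t`. -/
lemma card_filter_freeSet_le {f : ℤ[X]} {n h D : ℕ} (hf : 1 ≤ f.natDegree) (hn : 1 ≤ n)
    (hh : 1 ≤ h) (hD : ∀ m : ℕ, m ≠ 0 → m ≤ h ^ (n ^ 2) → m.divisors.card ≤ D) (j : Fin n)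
    (T : Finset ℤ) (A : ℤ → Finset ℤ) (B : ℤ → ℝ) (hB : ∀ t ∈ T, 0 ≤ B t)
    (hA : ∀ t ∈ T, f.eval (-t) ≠ 0 → ∀ g : Fin n → ℕ, ∏ i, g i = (f.eval (-t)).natAbs →
      (∀ i, ∃ x ∈ A t, x ≠ t ∧ (g i : ℤ) ∣ x - t) →
      ∏ i, (((A t).filter fun x => x ≠ t ∧ (g i : ℤ) ∣ x - t).card : ℝ) ≤ B t)
    {S : Finset ((Fin n → ℤ) × (Fin n → ℤ))} (hS : S ⊆ freeSet f n h)
    (hST : ∀ xy ∈ S, xy.2 j ∈ T ∧ ∀ i, xy.1 i ∈ A (xy.2 j)) :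
    (S.card : ℝ) ≤ ((2 * D * f.natDegree : ℕ) : ℝ) ^ n * (D ^ n * ∑ t ∈ T, B t) := by
  classical
  set T' := T.filter fun t => f.eval (-t) ≠ 0 ∧ (f.eval (-t)).natAbs ≤ h ^ n with hT'
  have hsub : S.image Prod.fst ⊆ T'.biUnion fun t =>
      (Fintype.piFinset fun _ : Fin n => A t).filter fun x =>
        (∀ i, x i ≠ t) ∧ ((f.eval (-t)).natAbs : ℤ) ∣ ∏ i, (x i - t) := by
    intro x hx
    obtain ⟨⟨x, y⟩, hxy, rfl⟩ := Finset.mem_image.1 hx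
    obtain ⟨hT, hA'⟩ := hST _ hxy
    have h1 := eval_neg_of_mem_freeSet (hS hxy) j
    have h2 := mem_freeSet.1 (hS hxy)
    simp only [Finset.mem_biUnion, Finset.mem_filter, Fintype.mem_piFinset, hT']
    exact ⟨y j, ⟨hT, h1⟩, hA', fun i => h2.2.2.2 i j,
      Int.natAbs_dvd.2 (eval_neg_dvd_prod_sub h2.2.2.1 j)⟩
  have hcard : ((S.image Prod.fst).card : ℝ) ≤ D ^ n * ∑ t ∈ T, B t := by
    calc ((S.image Prod.fst).card : ℝ) ≤ ∑ t ∈ T', (((Fintype.piFinset fun _ : Fin n => A t).filter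
            fun x => (∀ i, x i ≠ t) ∧ ((f.eval (-t)).natAbs : ℤ) ∣ ∏ i, (x i - t)).card : ℝ) := by
          exact_mod_cast (Finset.card_le_card hsub).trans Finset.card_biUnion_le
      _ ≤ ∑ t ∈ T', (D : ℝ) ^ n * B t := by
          apply Finset.sum_le_sum
          intro t ht
          obtain ⟨htT, ht0, ht1⟩ := Finset.mem_filter.1 ht
          refine (card_dvd_prod_sub_le (by simpa using ht0) (A t) t (hB t htT)
            (hA t htT ht0)).trans ?_
          have h2 : (f.eval (-t)).natAbs.divisors.card ≤ D := by
            refine hD _ (by simpa using ht0) (ht1.trans ?_)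
            exact Nat.pow_le_pow_right hh (by nlinarith)
          have := hB t htT
          gcongr
      _ ≤ ∑ t ∈ T, (D : ℝ) ^ n * B t :=
          Finset.sum_le_sum_of_subset_of_nonneg (Finset.filter_subset _ _) fun t ht _ =>
            mul_nonneg (by positivity) (hB t ht)
      _ = _ := by rw [Finset.mul_sum]
  calc (S.card : ℝ) ≤ ((2 * D * f.natDegree : ℕ) : ℝ) ^ n * ((S.image Prod.fst).card : ℝ) := by
        exact_mod_cast card_le_mul_card_image_fst hf hD hS
    _ ≤ _ := by gcongr

/-- A sum of reciprocals over distinct integers at distance at least one from `β`. -/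
lemma sum_inv_sub_le {h : ℕ} {β : ℝ} {S : Finset ℤ} (hS : S ⊆ Finset.Icc 1 (h : ℤ))
    (hβ : ∀ y ∈ S, β + 1 ≤ y) : ∑ y ∈ S, 1 / ((y : ℝ) - β) ≤ harmonic h := by
  classical
  set Y := max 1 ⌈β + 1⌉ with hY
  have hYS : ∀ y ∈ S, Y ≤ y ∧ y ≤ h := fun y hy =>
    ⟨max_le (Finset.mem_Icc.1 (hS hy)).1 (Int.ceil_le.2 (hβ y hy)), (Finset.mem_Icc.1 (hS hy)).2⟩
  have hY1 : 1 ≤ Y := le_max_left _ _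
  have hYβ : β + 1 ≤ Y := (Int.le_ceil _).trans (by exact_mod_cast le_max_right _ _)
  calc ∑ y ∈ S, 1 / ((y : ℝ) - β) ≤ ∑ y ∈ S, 1 / (((y - Y).toNat : ℝ) + 1) := by
        apply Finset.sum_le_sum
        intro y hy
        have h1 := (hYS y hy).1
        have h2 : (((y - Y).toNat : ℤ) : ℝ) = ((y - Y : ℤ) : ℝ) := by
          rw [Int.toNat_of_nonneg (by omega)]
        push_cast at h2
        rw [h2]
        have h3 : (Y : ℝ) ≤ y := by exact_mod_cast h1
        apply one_div_le_one_div_of_le <;> linarith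
    _ = ∑ k ∈ S.image fun y => (y - Y).toNat, 1 / ((k : ℝ) + 1) := by
        rw [Finset.sum_image]
        intro a ha b hb hab
        have := hYS a ha
        have := hYS b hb
        dsimp only at hab
        omega
    _ ≤ ∑ k ∈ Finset.range h, 1 / ((k : ℝ) + 1) := by
        apply Finset.sum_le_sum_of_subset_of_nonneg
        · intro k hk
          obtain ⟨y, hy, rfl⟩ := Finset.mem_image.1 hk
          have := hYS y hy
          rw [Finset.mem_range]
          omega
        · intros; positivity
    _ = _ := by
        rw [harmonic]
        push_cast
        simp

lemma sum_inv_abs_sub_le {h : ℕ} {β : ℝ} {S : Finset ℤ} (hS : S ⊆ Finset.Icc 1 (h : ℤ))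
    (hβ : ∀ y ∈ S, 1 ≤ |(y : ℝ) - β|) : ∑ y ∈ S, 1 / |(y : ℝ) - β| ≤ 2 * harmonic h := by
  classical
  rw [← Finset.sum_filter_add_sum_filter_not S (fun y : ℤ => β ≤ y), two_mul]
  refine add_le_add ?_ ?_
  · refine le_trans (le_of_eq ?_) (sum_inv_sub_le (β := β)
      ((Finset.filter_subset (fun y : ℤ => β ≤ y) S).trans hS) ?_)
    · refine Finset.sum_congr rfl fun y hy => ?_
      rw [abs_of_nonneg (sub_nonneg.2 (Finset.mem_filter.1 hy).2)]
    · intro y hy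
      obtain ⟨h1, h2⟩ := Finset.mem_filter.1 hy
      have := hβ y h1
      rw [abs_of_nonneg (by linarith)] at this
      linarith
  · have key := sum_inv_sub_le (h := h) (β := h + 1 - β)
      (S := (S.filter fun y : ℤ => ¬ β ≤ y).image fun y => (h : ℤ) + 1 - y) ?_ ?_
    · rw [Finset.sum_image (fun a _ b _ hab => by simpa using hab)] at key
      refine le_trans (le_of_eq ?_) key
      refine Finset.sum_congr rfl fun y hy => ?_
      have := (Finset.mem_filter.1 hy).2
      rw [abs_of_neg (by linarith)]
      push_cast
      ring
    · intro z hz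
      obtain ⟨y, hy, rfl⟩ := Finset.mem_image.1 hz
      have := Finset.mem_Icc.1 (hS (Finset.mem_filter.1 hy).1)
      rw [Finset.mem_Icc]
      omega
    · intro z hz
      obtain ⟨y, hy, rfl⟩ := Finset.mem_image.1 hz
      obtain ⟨h1, h2⟩ := Finset.mem_filter.1 hy
      have := hβ y h1
      rw [abs_of_neg (by linarith)] at this
      push_cast
      linarith

lemma card_filter_abs_lt_one_le (S : Finset ℤ) (β : ℝ) :
    (S.filter fun t : ℤ => |(t : ℝ) - β| < 1).card ≤ 2 := by
  calc _ ≤ (Finset.Icc ⌊β⌋ ⌈β⌉).card := by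
        apply Finset.card_le_card
        intro t ht
        obtain ⟨h1, h2⟩ := abs_lt.1 (Finset.mem_filter.1 ht).2
        have h3 := Int.floor_le β
        have h4 := Int.le_ceil β
        rw [Finset.mem_Icc]
        constructor
        · have : (⌊β⌋ : ℝ) < ((t + 1 : ℤ) : ℝ) := by push_cast; linarith
          have : ⌊β⌋ < t + 1 := by exact_mod_cast this
          omega
        · have : (t : ℝ) < ((⌈β⌉ + 1 : ℤ) : ℝ) := by push_cast; linarith
          have : t < ⌈β⌉ + 1 := by exact_mod_cast this
          omega
    _ ≤ 2 := by
        rw [Int.card_Icc]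
        have := Int.ceil_le_floor_add_one β
        omega

lemma card_filter_box_apply_mem_le {n h : ℕ} (j : Fin n) (s : Finset ℤ) :
    ((box n h).filter fun y => y j ∈ s).card ≤ s.card * h ^ (n - 1) := by
  classical
  calc _ ≤ (Fintype.piFinset fun i => if i = j then s else Finset.Icc 1 (h : ℤ)).card := by
        apply Finset.card_le_card
        intro y hy
        rw [Finset.mem_filter, mem_box] at hy
        rw [Fintype.mem_piFinset]
        intro i
        split_ifs with hij
        · exact hij ▸ hy.2
        · exact Finset.mem_Icc.2 (hy.1 i)
    _ = _ := by
        rw [Fintype.card_piFinset, ← Finset.mul_prod_erase _ _ (Finset.mem_univ j), if_pos rfl,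
          Finset.prod_congr rfl (g := fun _ => h)]
        · simp
        · intro i hi
          rw [if_neg (Finset.ne_of_mem_erase hi)]
          simp

/-- The contribution of a linear polynomial with a large coefficient. -/
lemma card_freeSet_le_of_natDegree_eq_one {f : ℤ[X]} {n h D : ℕ} {Δ H : ℝ}
    (hf : f.natDegree = 1) (hn : 1 ≤ n) (hh : 1 ≤ h)
    (hD : ∀ m : ℕ, m ≠ 0 → m ≤ h ^ (n ^ 2) → m.divisors.card ≤ D)
    (hΔ : 1 ≤ Δ) (hΔh : Δ ≤ h) (hH1 : 1 ≤ H) (hH : (harmonic h : ℝ) ≤ H)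
    (hbe : Δ < |(f.coeff 1 : ℝ)| ∨ 2 * h * Δ < |(f.coeff 0 : ℝ)|) :
    ((freeSet f n h).card : ℝ) ≤ (2 * D : ℝ) ^ n * (D ^ n * (2 * H / Δ * h ^ n)) +
      (2 * D : ℝ) ^ n * (2 * (h ^ n / Δ)) := by
  classical
  set b := f.coeff 1 with hb
  set e := f.coeff 0 with he
  have hb0 : b ≠ 0 := by
    rw [hb, ← hf]
    exact leadingCoeff_ne_zero.2 (by rintro rfl; simp at hf)
  have hbR : (b : ℝ) ≠ 0 := by exact_mod_cast hb0
  have hbpos : 0 < |(b : ℝ)| := abs_pos.2 hbR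
  have hhpos : (0 : ℝ) < h := by exact_mod_cast hh
  have hev : ∀ t : ℤ, (((f.eval (-t)).natAbs : ℕ) : ℝ) = |(b : ℝ)| * |(t : ℝ) - e / b| := by
    intro t
    rw [Nat.cast_natAbs, eq_X_add_C_of_natDegree_le_one hf.le, eval_add, eval_mul, eval_C, eval_C,
      eval_X, ← hb, ← he, ← abs_mul, mul_sub, mul_div_cancel₀ _ hbR, ← abs_neg]
    push_cast
    ring_nf
  set T := (Finset.Icc 1 (h : ℤ)).filter fun t : ℤ => ¬ |(t : ℝ) - e / b| < 1 with hT
  set j : Fin n := ⟨0, hn⟩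
  have hsum : ∑ t ∈ T, 1 / (((f.eval (-t)).natAbs : ℕ) : ℝ) ≤ 2 * H / Δ := by
    by_cases hbΔ : Δ < |(b : ℝ)|
    · calc _ = (1 / |(b : ℝ)|) * ∑ t ∈ T, 1 / |(t : ℝ) - e / b| := by
            rw [Finset.mul_sum]
            refine Finset.sum_congr rfl fun t _ => ?_
            rw [hev, one_div_mul_one_div]
        _ ≤ (1 / |(b : ℝ)|) * (2 * harmonic h) := by
            gcongr
            exact sum_inv_abs_sub_le (Finset.filter_subset _ _)
              fun t ht => not_lt.1 (Finset.mem_filter.1 ht).2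
        _ ≤ (1 / Δ) * (2 * H) := by
            have : (0 : ℝ) ≤ harmonic h := by
              rw [harmonic]; push_cast; positivity
            gcongr
        _ = _ := by ring
    · have he' : 2 * h * Δ < |(e : ℝ)| := hbe.resolve_left hbΔ
      calc _ ≤ ∑ _t ∈ T, 1 / (h * Δ) := by
            apply Finset.sum_le_sum
            intro t ht
            have ht' := Finset.mem_Icc.1 (Finset.mem_filter.1 ht).1
            have ht1 : (1 : ℝ) ≤ t := by exact_mod_cast ht'.1
            have ht2 : (t : ℝ) ≤ h := by exact_mod_cast ht'.2
            apply one_div_le_one_div_of_le (by positivity)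
            rw [hev, ← abs_mul, mul_sub, mul_div_cancel₀ _ hbR]
            have h1 : |(b : ℝ) * t| ≤ Δ * h := by
              rw [abs_mul, abs_of_nonneg (by linarith : (0 : ℝ) ≤ t)]
              exact mul_le_mul (not_lt.1 hbΔ) ht2 (by linarith) (by linarith)
            have h2 := abs_sub_abs_le_abs_sub (e : ℝ) (b * t)
            rw [abs_sub_comm] at h2
            linarith
        _ ≤ h * (1 / (h * Δ)) := by
            rw [Finset.sum_const, nsmul_eq_mul]
            gcongr
            exact_mod_cast (Finset.card_filter_le _ _).trans (by simp)
        _ = 1 / Δ := by field_simp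
        _ ≤ 2 * H / Δ := by gcongr; linarith
  rw [← Finset.card_filter_add_card_filter_not (s := freeSet f n h) fun xy => xy.2 j ∈ T]
  push_cast
  refine add_le_add ?_ ?_
  · have := card_filter_freeSet_le (f := f) (n := n) (h := h) (D := D) hf.ge hn hh hD j T
      (fun _ => Finset.Icc 1 (h : ℤ)) (fun t => (h : ℝ) ^ n / ((f.eval (-t)).natAbs : ℕ))
      (fun t _ => by positivity) (by
        intro t ht ht0 g hg _
        have hgi : ∀ i, 1 ≤ g i := fun i => Nat.one_le_iff_ne_zero.2 fun h0 => by
          rw [Finset.prod_eq_zero (Finset.mem_univ i) h0] at hg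
          exact ht0 (by simpa using hg.symm)
        calc _ ≤ ∏ i, ((h : ℝ) / g i) := Finset.prod_le_prod (fun _ _ => by positivity)
              fun i _ => card_filter_dvd_sub_le (hgi i) (Finset.mem_filter.1 ht).1
          _ = _ := by
              rw [Finset.prod_div_distrib, ← hg]
              simp) (Finset.filter_subset (fun xy => xy.2 j ∈ T) (freeSet f n h)) (by
        rintro ⟨x, y⟩ hxy
        obtain ⟨h1, h2⟩ := Finset.mem_filter.1 hxy
        exact ⟨h2, fun i => Finset.mem_Icc.2 (mem_box.1 (mem_freeSet.1 h1).1 i)⟩)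
    refine this.trans ?_
    rw [hf]
    push_cast
    rw [mul_one]
    have e1 : ∑ t ∈ T, (h : ℝ) ^ n / ((f.eval (-t)).natAbs : ℕ) =
        (∑ t ∈ T, 1 / (((f.eval (-t)).natAbs : ℕ) : ℝ)) * h ^ n := by
      rw [Finset.sum_mul]
      exact Finset.sum_congr rfl fun _ _ => by ring
    rw [e1]
    gcongr
  · set S := (freeSet f n h).filter fun xy => ¬ xy.2 j ∈ T with hS
    have h1 : (S.image Prod.swap) ⊆ freeSet f n h := by
      intro z hz
      obtain ⟨⟨x, y⟩, hxy, rfl⟩ := Finset.mem_image.1 hz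
      exact swap_mem_freeSet (Finset.mem_filter.1 hxy).1
    have h2 := card_le_mul_card_image_fst hf.ge hD h1
    rw [card_image_swap_freeSet, hf, mul_one] at h2
    have h3 : ((S.image Prod.swap).image Prod.fst).card ≤ 2 * h ^ (n - 1) := by
      refine le_trans (Finset.card_le_card (t := (box n h).filter fun y => y j ∈
        (Finset.Icc 1 (h : ℤ)).filter fun t : ℤ => |(t : ℝ) - e / b| < 1) ?_)
        ((card_filter_box_apply_mem_le j _).trans
          (Nat.mul_le_mul_right _ (card_filter_abs_lt_one_le _ _)))
      intro y' hy'
      obtain ⟨z, hz, rfl⟩ := Finset.mem_image.1 hy'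
      obtain ⟨⟨x, y⟩, hxy, rfl⟩ := Finset.mem_image.1 hz
      obtain ⟨h1, h2⟩ := Finset.mem_filter.1 hxy
      have hy := (mem_freeSet.1 h1).2.1
      have hyj := Finset.mem_Icc.2 (mem_box.1 hy j)
      refine Finset.mem_filter.2 ⟨hy, Finset.mem_filter.2 ⟨hyj, ?_⟩⟩
      by_contra hcon
      exact h2 (Finset.mem_filter.2 ⟨hyj, hcon⟩)
    have h4 : (S.card : ℝ) ≤ (2 * D : ℝ) ^ n * (2 * h ^ (n - 1)) := by
      exact_mod_cast h2.trans (Nat.mul_le_mul_left _ h3)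
    refine h4.trans ?_
    gcongr
    rw [le_div_iff₀ (by linarith)]
    calc (h : ℝ) ^ (n - 1) * Δ ≤ h ^ (n - 1) * h := by gcongr
      _ = h ^ n := by rw [← pow_succ, Nat.sub_add_cancel hn]

lemma exists_prod_norm_add_le_natAbs_eval {f : ℤ[X]} (hf : f ≠ 0) :
    ∃ α : Fin f.natDegree → ℂ, ∀ t : ℤ,
      ∏ k, ‖(t : ℂ) + α k‖ ≤ ((f.eval (-t)).natAbs : ℕ) := by
  set F := f.map (Int.castRingHom ℂ) with hF
  have hinj : Function.Injective (Int.castRingHom ℂ) := Int.cast_injective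
  have hsplit : F.Splits := IsAlgClosed.splits F
  have hcard : F.roots.toList.length = f.natDegree := by
    rw [Multiset.length_toList, ← hsplit.natDegree_eq_card_roots, hF,
      natDegree_map_eq_of_injective hinj]
  refine ⟨fun k => F.roots.toList.get (k.cast hcard.symm), fun t => ?_⟩
  have h1 : F.eval (-(t : ℂ)) = ((f.eval (-t) : ℤ) : ℂ) := by
    rw [hF, eval_map, ← Int.cast_neg, eval₂_at_intCast]
    simp
  have h2 := hsplit.eval_eq_prod_roots (-(t : ℂ))
  have h3 : ((f.eval (-t)).natAbs : ℝ) = ‖F.eval (-(t : ℂ))‖ := by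
    rw [h1, Complex.norm_intCast, Nat.cast_natAbs]
    push_cast
    rfl
  have hl : (1 : ℝ) ≤ ‖F.leadingCoeff‖ := by
    rw [hF, leadingCoeff_map_of_injective hinj]
    rw [eq_intCast, Complex.norm_intCast]
    exact_mod_cast Int.one_le_abs (leadingCoeff_ne_zero.2 hf)
  have h4 : ∏ k : Fin f.natDegree, ‖(t : ℂ) + F.roots.toList.get (k.cast hcard.symm)‖ =
      ‖(F.roots.map fun a => -(t : ℂ) - a).prod‖ := by
    have e1 : (F.roots.map fun a => -(t : ℂ) - a) =
        ((F.roots.toList.map fun a => -(t : ℂ) - a : List ℂ) : Multiset ℂ) := by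
      conv_lhs => rw [← Multiset.coe_toList F.roots]
      rw [Multiset.map_coe]
    have e2 : (F.roots.toList.map fun a => -(t : ℂ) - a) = List.ofFn fun k : Fin f.natDegree =>
        -(t : ℂ) - F.roots.toList.get (k.cast hcard.symm) :=
      List.ext_getElem (by simp [hcard]) (by simp)
    rw [e1, Multiset.prod_coe, e2, List.prod_ofFn, norm_prod]
    refine Finset.prod_congr rfl fun k _ => ?_
    rw [← norm_neg, neg_add']
  rw [h3, h2, norm_mul, h4]
  exact le_mul_of_one_le_left (norm_nonneg _) hl

lemma sq_le_two_mul_prod_min {n : ℕ} {g : Fin n → ℝ} {Y : ℝ} (hg : ∀ i, 1 ≤ g i) (hY : 1 ≤ Y)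
    (h1 : Y ^ 2 ≤ ∏ i, g i) (h2 : ∀ i, g i * Y ≤ 2 * ∏ i, g i) :
    Y ^ 2 ≤ 2 * ∏ i, min (g i) Y := by
  have hmin : ∀ i, 1 ≤ min (g i) Y := fun i => le_min (hg i) hY
  by_cases hall : ∀ i, g i ≤ Y
  · have : ∏ i, min (g i) Y = ∏ i, g i := Finset.prod_congr rfl fun i _ => min_eq_left (hall i)
    rw [this]
    nlinarith
  push Not at hall
  obtain ⟨a, ha⟩ := hall
  rw [← Finset.mul_prod_erase _ _ (Finset.mem_univ a), min_eq_right ha.le]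
  suffices Y ≤ 2 * ∏ i ∈ Finset.univ.erase a, min (g i) Y by nlinarith
  by_cases hall' : ∀ i ∈ Finset.univ.erase a, g i ≤ Y
  · rw [Finset.prod_congr rfl fun i hi => min_eq_left (hall' i hi)]
    have := h2 a
    rw [← Finset.mul_prod_erase _ _ (Finset.mem_univ a)] at this
    have ha0 : 0 < g a := by linarith [hg a]
    nlinarith
  · push Not at hall'
    obtain ⟨c, hc, hcY⟩ := hall'
    rw [← Finset.mul_prod_erase _ _ hc, min_eq_right hcY.le]
    have : 1 ≤ ∏ i ∈ (Finset.univ.erase a).erase c, min (g i) Y :=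
      Finset.prod_induction _ (1 ≤ ·) (fun _ _ => one_le_mul_of_one_le_of_one_le) le_rfl
        fun i _ => hmin i
    nlinarith

/-- Counting in arithmetic progressions near the roots `-αₖ`, restricted to points which are at
least as close to the roots as `t`. -/
lemma prod_card_filter_near_roots_le {n d h : ℕ} (hn : 2 ≤ n) (hd : 2 ≤ d) {α : Fin d → ℂ}
    {ρ : ℤ → ℝ} (hρ : ∀ t, ∃ k, ρ t = ‖(t : ℂ) + α k‖) (hρ' : ∀ t k, ρ t ≤ ‖(t : ℂ) + α k‖)
    {t : ℤ} (ht : t ∈ Finset.Icc 1 (h : ℤ)) {g : Fin n → ℕ} (hg0 : ∏ i, g i ≠ 0)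
    (hprod : ∏ k, ‖(t : ℂ) + α k‖ ≤ ((∏ i, g i : ℕ) : ℝ))
    (hex : ∀ i, ∃ x ∈ (Finset.Icc 1 (h : ℤ)).filter fun x => ρ x ≤ ρ t,
      x ≠ t ∧ (g i : ℤ) ∣ x - t) :
    ∏ i, ((((Finset.Icc 1 (h : ℤ)).filter fun x => ρ x ≤ ρ t).filter fun x =>
      x ≠ t ∧ (g i : ℤ) ∣ x - t).card : ℝ) ≤ 2 * (3 * d) ^ n * (h : ℝ) ^ (n - 2) := by
  classical
  have hh : 1 ≤ h := by have := Finset.mem_Icc.1 ht; omega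
  have hhR : (1 : ℝ) ≤ h := by exact_mod_cast hh
  set r := ρ t with hr
  have hr0 : 0 ≤ r := by obtain ⟨k, hk⟩ := hρ t; rw [hr, hk]; positivity
  set Y := max 1 (min r h) with hY
  have hY1 : 1 ≤ Y := le_max_left _ _
  have hYh : Y ≤ h := max_le hhR (min_le_right _ _)
  have hg1 : ∀ i, (1 : ℝ) ≤ g i := fun i => by
    have := Finset.prod_ne_zero_iff.1 hg0 i (Finset.mem_univ i)
    exact_mod_cast Nat.one_le_iff_ne_zero.2 this
  have hcount : ∀ i, ((((Finset.Icc 1 (h : ℤ)).filter fun x => ρ x ≤ r).filter fun x =>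
      x ≠ t ∧ (g i : ℤ) ∣ x - t).card : ℝ) ≤ 3 * d * Y / min (g i : ℝ) Y := by
    intro i
    set S := ((Finset.Icc 1 (h : ℤ)).filter fun x => ρ x ≤ r).filter fun x =>
      x ≠ t ∧ (g i : ℤ) ∣ x - t with hS
    have hsub : S ⊆ Finset.univ.biUnion fun k => S.filter fun x => ‖(x : ℂ) + α k‖ ≤ r := by
      intro x hx
      obtain ⟨k, hk⟩ := hρ x
      refine Finset.mem_biUnion.2 ⟨k, Finset.mem_univ k, Finset.mem_filter.2 ⟨hx, ?_⟩⟩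
      rw [← hk]
      exact (Finset.mem_filter.1 (Finset.mem_filter.1 hx).1).2
    have hmin : 0 < min (g i : ℝ) Y := lt_min (by linarith [hg1 i]) (by linarith)
    have hk : ∀ k, ((S.filter fun x : ℤ => ‖(x : ℂ) + α k‖ ≤ r).card : ℝ) ≤
        3 * Y / min (g i : ℝ) Y := by
      intro k
      have := card_le_of_dvd_sub (S := S.filter fun x : ℤ => ‖(x : ℂ) + α k‖ ≤ r) (g := g i)
        (by exact_mod_cast hg1 i) (L := 2 * Y) (by linarith) (by
          intro x hx y hy
          obtain ⟨hxS, hxr⟩ := Finset.mem_filter.1 hx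
          obtain ⟨hyS, hyr⟩ := Finset.mem_filter.1 hy
          obtain ⟨hx1, hx2, hx3⟩ := Finset.mem_filter.1 hxS
          obtain ⟨hy1, hy2, hy3⟩ := Finset.mem_filter.1 hyS
          have hx4 := Finset.mem_Icc.1 (Finset.mem_filter.1 hx1).1
          have hy4 := Finset.mem_Icc.1 (Finset.mem_filter.1 hy1).1
          refine ⟨?_, by simpa using dvd_sub hx3 hy3⟩
          have b1 : ((x - y : ℤ) : ℝ) ≤ h := by
            have : x - y ≤ (h : ℤ) := by omega
            exact_mod_cast this
          have b2 : ((x - y : ℤ) : ℝ) ≤ 2 * r := by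
            calc ((x - y : ℤ) : ℝ) ≤ ‖((x - y : ℤ) : ℂ)‖ := by
                  rw [Complex.norm_intCast]; exact le_abs_self _
              _ = ‖((x : ℂ) + α k) - ((y : ℂ) + α k)‖ := by push_cast; ring_nf
              _ ≤ 2 * r := (norm_sub_le _ _).trans (by linarith)
          have b3 : min r h ≤ Y := le_max_right _ _
          rcases min_choice r (h : ℝ) with b4 | b4 <;> rw [b4] at b3 <;> linarith)
      refine this.trans ?_
      calc 2 * Y / g i + 1 ≤ 2 * Y / min (g i : ℝ) Y + Y / min (g i : ℝ) Y := by
            gcongr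
            · exact min_le_left _ _
            · rw [le_div_iff₀ hmin, one_mul]; exact min_le_right _ _
        _ = _ := by ring
    calc (S.card : ℝ) ≤ ∑ k : Fin d, ((S.filter fun x : ℤ => ‖(x : ℂ) + α k‖ ≤ r).card : ℝ) := by
          exact_mod_cast (Finset.card_le_card hsub).trans Finset.card_biUnion_le
      _ ≤ ∑ _k : Fin d, 3 * Y / min (g i : ℝ) Y := Finset.sum_le_sum fun k _ => hk k
      _ = _ := by
          rw [Finset.sum_const, Finset.card_univ, Fintype.card_fin, nsmul_eq_mul]
          ring
  have hclaim : Y ^ 2 ≤ 2 * ∏ i, min (g i : ℝ) Y := by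
    by_cases hr1 : r ≤ 1
    · have hY1' : Y = 1 := max_eq_left ((min_le_left _ _).trans hr1)
      have : 1 ≤ ∏ i, min (g i : ℝ) Y :=
        Finset.prod_induction _ (1 ≤ ·) (fun _ _ => one_le_mul_of_one_le_of_one_le) le_rfl
          fun i _ => le_min (hg1 i) hY1
      rw [hY1'] at this ⊢
      linarith
    have hr1' : 1 ≤ r := (not_le.1 hr1).le
    have hYr : Y ≤ r := max_le hr1' (min_le_left _ _)
    push_cast at hprod
    refine sq_le_two_mul_prod_min hg1 hY1 ?_ fun i => ?_
    · calc Y ^ 2 ≤ r ^ 2 := by gcongr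
        _ ≤ r ^ d := pow_le_pow_right₀ hr1' hd
        _ = ∏ _k : Fin d, r := by simp
        _ ≤ ∏ k, ‖(t : ℂ) + α k‖ := Finset.prod_le_prod (fun _ _ => hr0) fun k _ => hρ' t k
        _ ≤ _ := hprod
    · obtain ⟨x, hx, hxt, hdvd⟩ := hex i
      obtain ⟨k, hk⟩ := hρ x
      have hxr : ‖(x : ℂ) + α k‖ ≤ r := hk ▸ (Finset.mem_filter.1 hx).2
      have hgi : (g i : ℝ) ≤ 2 * ‖(t : ℂ) + α k‖ := by
        have h1 : (g i : ℤ) ≤ |x - t| :=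
          Int.le_of_dvd (abs_pos.2 (sub_ne_zero.2 hxt)) ((dvd_abs _ _).2 hdvd)
        calc (g i : ℝ) ≤ ((|x - t| : ℤ) : ℝ) := by exact_mod_cast h1
          _ = ‖((x - t : ℤ) : ℂ)‖ := by rw [Complex.norm_intCast, Int.cast_abs]
          _ = ‖((x : ℂ) + α k) - ((t : ℂ) + α k)‖ := by push_cast; ring_nf
          _ ≤ ‖(x : ℂ) + α k‖ + ‖(t : ℂ) + α k‖ := norm_sub_le _ _
          _ ≤ _ := by linarith [hρ' t k]
      have hP : ‖(t : ℂ) + α k‖ * Y ≤ ∏ i, (g i : ℝ) := by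
        refine le_trans ?_ hprod
        rw [← Finset.mul_prod_erase _ _ (Finset.mem_univ k)]
        gcongr
        calc Y ≤ r ^ 1 := by rwa [pow_one]
          _ ≤ r ^ (d - 1) := pow_le_pow_right₀ hr1' (by omega)
          _ = ∏ _l ∈ Finset.univ.erase k, r := by
              rw [Finset.prod_const, Finset.card_erase_of_mem (Finset.mem_univ k)]
              simp
          _ ≤ _ := Finset.prod_le_prod (fun _ _ => hr0) fun l _ => hρ' t l
      nlinarith
  have hmpos : 0 < ∏ i, min (g i : ℝ) Y :=
    Finset.prod_pos fun i _ => lt_min (by linarith [hg1 i]) (by linarith)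
  calc _ ≤ ∏ i, (3 * d * Y / min (g i : ℝ) Y) :=
        Finset.prod_le_prod (fun _ _ => by positivity) fun i _ => hcount i
    _ = (3 * d) ^ n * (Y ^ (n - 2) * Y ^ 2) / ∏ i, min (g i : ℝ) Y := by
        rw [Finset.prod_div_distrib, Finset.prod_const, Finset.card_univ, Fintype.card_fin,
          mul_pow, ← pow_add, Nat.sub_add_cancel hn]
    _ ≤ 2 * (3 * d) ^ n * Y ^ (n - 2) := by
        rw [div_le_iff₀ hmpos]
        have : 0 ≤ (3 * d : ℝ) ^ n * Y ^ (n - 2) := by positivity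
        nlinarith [mul_le_mul_of_nonneg_left hclaim this]
    _ ≤ _ := by gcongr

lemma natDegree_le_of_mem_freeSet {f : ℤ[X]} {n h : ℕ} (hn : 1 ≤ n) {x y : Fin n → ℤ}
    (hxy : (x, y) ∈ freeSet f n h) : f.natDegree ≤ n - 1 := by
  have h1 := (mem_freeSet.1 hxy).2.2
  have hne : shiftPoly x - shiftPoly y ≠ 0 := by
    intro h0
    have h2 := congrArg (fun q => q.eval (-y ⟨0, hn⟩)) (sub_eq_zero.1 h0)
    simp only [eval_shiftPoly] at h2
    rw [Finset.prod_eq_zero (f := fun i => -y ⟨0, hn⟩ + y i) (Finset.mem_univ ⟨0, hn⟩) (by ring)]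
      at h2
    obtain ⟨i, _, hi⟩ := Finset.prod_eq_zero_iff.1 h2
    exact h1.2 i ⟨0, hn⟩ (by linarith)
  exact (natDegree_le_of_dvd h1.1 hne).trans (natDegree_shiftPoly_sub_lt hn x y)

/-- The contribution of a nonlinear polynomial. -/
lemma card_freeSet_le_of_two_le_natDegree {f : ℤ[X]} {n h D : ℕ}
    (hf : 2 ≤ f.natDegree) (hn : 1 ≤ n) (hh : 1 ≤ h)
    (hD : ∀ m : ℕ, m ≠ 0 → m ≤ h ^ (n ^ 2) → m.divisors.card ≤ D) :
    ((freeSet f n h).card : ℝ) ≤ 2 * n * ((2 * D * f.natDegree) ^ n *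
      (D ^ n * (2 * (3 * f.natDegree) ^ n * (h : ℝ) ^ (n - 1)))) := by
  classical
  rcases (freeSet f n h).eq_empty_or_nonempty with hemp | ⟨⟨x₀, y₀⟩, h₀⟩
  · rw [hemp]; simp; positivity
  have hn2 : 2 ≤ n := by have := natDegree_le_of_mem_freeSet hn h₀; omega
  have hf0 : f ≠ 0 := by rintro rfl; simp at hf
  obtain ⟨α, hα⟩ := exists_prod_norm_add_le_natAbs_eval hf0
  have hne : Nonempty (Fin f.natDegree) := ⟨⟨0, by omega⟩⟩
  have hmin : ∀ t : ℤ, ∃ k, ∀ l, ‖(t : ℂ) + α k‖ ≤ ‖(t : ℂ) + α l‖ := fun t =>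
    Finite.exists_min fun k => ‖(t : ℂ) + α k‖
  choose κ hκ using hmin
  set ρ : ℤ → ℝ := fun t => ‖(t : ℂ) + α (κ t)‖ with hρ
  set C : ℝ := (2 * D * f.natDegree) ^ n *
      (D ^ n * (2 * (3 * f.natDegree) ^ n * (h : ℝ) ^ (n - 1))) with hC
  have key : ∀ (j : Fin n) (S : Finset ((Fin n → ℤ) × (Fin n → ℤ))), S ⊆ freeSet f n h →
      (∀ xy ∈ S, ∀ i, ρ (xy.1 i) ≤ ρ (xy.2 j)) → (S.card : ℝ) ≤ C := by
    intro j S hS hSρ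
    have := card_filter_freeSet_le (by omega) hn hh hD j (Finset.Icc 1 (h : ℤ))
      (fun t => (Finset.Icc 1 (h : ℤ)).filter fun x => ρ x ≤ ρ t)
      (fun _ => 2 * (3 * f.natDegree) ^ n * (h : ℝ) ^ (n - 2)) (fun _ _ => by positivity) (by
        intro t ht ht0 g hg hex
        refine prod_card_filter_near_roots_le hn2 hf (fun t => ⟨κ t, rfl⟩) (fun t k => hκ t k) ht
          (by rw [hg]; simpa using ht0) (by rw [hg]; exact hα t) hex) hS (by
        rintro ⟨x, y⟩ hxy
        have h1 := mem_freeSet.1 (hS hxy)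
        exact ⟨Finset.mem_Icc.2 (mem_box.1 h1.2.1 j), fun i => Finset.mem_filter.2
          ⟨Finset.mem_Icc.2 (mem_box.1 h1.1 i), hSρ _ hxy i⟩⟩)
    refine this.trans (le_of_eq ?_)
    rw [hC, Finset.sum_const, Int.card_Icc, nsmul_eq_mul]
    have e : (h : ℝ) ^ (n - 1) = h * h ^ (n - 2) := by
      rw [← pow_succ']; congr 1; omega
    rw [e, add_sub_cancel_right, Int.toNat_natCast]
    push_cast
    ring
  have hcover : freeSet f n h ⊆
      (Finset.univ.biUnion fun j => (freeSet f n h).filter fun xy => ∀ i, ρ (xy.1 i) ≤ ρ (xy.2 j)) ∪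
      (Finset.univ.biUnion fun j => (freeSet f n h).filter fun xy =>
        ∀ i, ρ (xy.2 i) ≤ ρ (xy.1 j)) := by
    rintro ⟨x, y⟩ hxy
    have hne' : Nonempty (Fin n) := ⟨⟨0, hn⟩⟩
    obtain ⟨a, ha⟩ := Finite.exists_max fun i => ρ (x i)
    obtain ⟨b, hb⟩ := Finite.exists_max fun i => ρ (y i)
    simp only [Finset.mem_union, Finset.mem_biUnion, Finset.mem_univ, true_and, Finset.mem_filter]
    rcases le_total (ρ (x a)) (ρ (y b)) with hab | hab
    · exact Or.inl ⟨b, hxy, fun i => (ha i).trans hab⟩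
    · exact Or.inr ⟨a, hxy, fun i => (hb i).trans hab⟩
  have h1 : ∀ j : Fin n, (((freeSet f n h).filter fun xy =>
      ∀ i, ρ (xy.1 i) ≤ ρ (xy.2 j)).card : ℝ) ≤ C := fun j =>
    key j _ (Finset.filter_subset _ _) fun xy hxy => (Finset.mem_filter.1 hxy).2
  have h2 : ∀ j : Fin n, (((freeSet f n h).filter fun xy =>
      ∀ i, ρ (xy.2 i) ≤ ρ (xy.1 j)).card : ℝ) ≤ C := fun j => by
    rw [← card_image_swap_freeSet]
    refine key j _ (fun z hz => ?_) fun z hz => ?_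
    · obtain ⟨⟨x, y⟩, hxy, rfl⟩ := Finset.mem_image.1 hz
      exact swap_mem_freeSet (Finset.mem_filter.1 hxy).1
    · obtain ⟨⟨x, y⟩, hxy, rfl⟩ := Finset.mem_image.1 hz
      exact (Finset.mem_filter.1 hxy).2
  have h3 := (Finset.card_le_card hcover).trans ((Finset.card_union_le _ _).trans
    (add_le_add Finset.card_biUnion_le Finset.card_biUnion_le))
  calc ((freeSet f n h).card : ℝ) ≤ ∑ _j : Fin n, C + ∑ _j : Fin n, C := by
        refine (Nat.cast_le.2 h3).trans ?_
        push_cast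
        exact add_le_add (Finset.sum_le_sum fun j _ => h1 j) (Finset.sum_le_sum fun j _ => h2 j)
    _ = _ := by
        rw [Finset.sum_const, Finset.card_univ, Fintype.card_fin, nsmul_eq_mul]
        ring

/-- Unless `f` is linear with small coefficients, few pairs without common entries are linked
through `f`. -/
lemma card_freeSet_le {f : ℤ[X]} {n ν h D : ℕ} {Δ H : ℝ} (hf : 1 ≤ f.natDegree)
    (hn : 1 ≤ n) (hnν : n ≤ ν) (hh : 1 ≤ h)
    (hD : ∀ m : ℕ, m ≠ 0 → m ≤ h ^ (ν ^ 2) → m.divisors.card ≤ D)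
    (hΔ : 1 ≤ Δ) (hΔh : Δ ≤ h) (hH1 : 1 ≤ H) (hH : (harmonic h : ℝ) ≤ H)
    (hbe : f.natDegree = 1 → Δ < |(f.coeff 1 : ℝ)| ∨ 2 * h * Δ < |(f.coeff 0 : ℝ)|) :
    ((freeSet f n h).card : ℝ) ≤
      4 * ν * (2 * ν) ^ ν * (3 * ν) ^ ν * (D : ℝ) ^ (2 * ν) * H * (h ^ n / Δ) := by
  have hDn : ∀ m : ℕ, m ≠ 0 → m ≤ h ^ (n ^ 2) → m.divisors.card ≤ D := fun m hm hm' =>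
    hD m hm (hm'.trans (Nat.pow_le_pow_right hh (Nat.pow_le_pow_left hnν 2)))
  have hD1 : 1 ≤ D := by
    have := hD 1 one_ne_zero (Nat.one_le_pow _ _ hh)
    simpa using this
  have hD1' : (1 : ℝ) ≤ D := by exact_mod_cast hD1
  have hν1 : (1 : ℝ) ≤ ν := by exact_mod_cast hn.trans hnν
  have hhR : (0 : ℝ) < h := by exact_mod_cast hh
  have hΔ0 : 0 < Δ := by linarith
  have hhn : (h : ℝ) ^ (n - 1) ≤ h ^ n / Δ := by
    rw [le_div_iff₀ (by linarith)]
    calc (h : ℝ) ^ (n - 1) * Δ ≤ h ^ (n - 1) * h := by gcongr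
      _ = h ^ n := by rw [← pow_succ, Nat.sub_add_cancel hn]
  have hX : 0 ≤ (h : ℝ) ^ n / Δ := by positivity
  have hDD : (D : ℝ) ^ n * D ^ n ≤ D ^ (2 * ν) := by
    rw [← pow_add]
    exact pow_le_pow_right₀ hD1' (by omega)
  rcases hf.eq_or_lt with hf1 | hf2
  · refine (card_freeSet_le_of_natDegree_eq_one hf1.symm hn hh hDn hΔ hΔh hH1 hH
      (hbe hf1.symm)).trans ?_
    calc (2 * D : ℝ) ^ n * (D ^ n * (2 * H / Δ * h ^ n)) + (2 * D : ℝ) ^ n * (2 * (h ^ n / Δ))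
        = 2 ^ n * (D ^ n * D ^ n * 1) * (2 * H) * (h ^ n / Δ) +
          2 ^ n * (D ^ n * 1) * (2 * 1) * (h ^ n / Δ) := by rw [mul_pow]; ring
      _ ≤ 2 ^ n * (D ^ n * D ^ n * 1) * (2 * H) * (h ^ n / Δ) +
          2 ^ n * (D ^ n * D ^ n) * (2 * H) * (h ^ n / Δ) := by
          gcongr
          exact one_le_pow₀ hD1'
      _ = 4 * 1 * 2 ^ n * 1 * (D ^ n * D ^ n) * H * (h ^ n / Δ) := by ring
      _ ≤ _ := by
          gcongr
          · calc (2 : ℝ) ^ n ≤ 2 ^ ν := pow_le_pow_right₀ (by norm_num) hnν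
              _ ≤ _ := by gcongr; linarith
          · exact one_le_pow₀ (by linarith)
  · rcases (freeSet f n h).eq_empty_or_nonempty with hemp | ⟨⟨x₀, y₀⟩, h₀⟩
    · rw [hemp]; simp; positivity
    have hdν : (f.natDegree : ℝ) ≤ ν := by
      have := natDegree_le_of_mem_freeSet hn h₀
      exact_mod_cast (by omega : f.natDegree ≤ ν)
    refine (card_freeSet_le_of_two_le_natDegree hf2 hn hh hDn).trans ?_
    calc _ = 4 * n * (2 * f.natDegree : ℝ) ^ n * (3 * f.natDegree) ^ n * (D ^ n * D ^ n) * 1 *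
          h ^ (n - 1) := by simp only [mul_pow]; ring
      _ ≤ 4 * ν * (2 * ν : ℝ) ^ n * (3 * ν) ^ n * D ^ (2 * ν) * H * (h ^ n / Δ) := by
          gcongr
      _ ≤ _ := by
          gcongr <;> linarith

open Classical in
/-- Pairs of tuples in the box with distinct associated polynomials that agree modulo `f` but are
not divisible by `f`. -/
noncomputable def linkSet (f : ℤ[X]) (n h : ℕ) : Finset ((Fin n → ℤ) × (Fin n → ℤ)) :=
  (box n h ×ˢ box n h).filter fun xy =>
    f ∣ shiftPoly xy.1 - shiftPoly xy.2 ∧ shiftPoly xy.1 ≠ shiftPoly xy.2 ∧ ¬ f ∣ shiftPoly xy.1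

lemma mem_linkSet {f : ℤ[X]} {n h : ℕ} {x y : Fin n → ℤ} : (x, y) ∈ linkSet f n h ↔
    x ∈ box n h ∧ y ∈ box n h ∧ f ∣ shiftPoly x - shiftPoly y ∧ shiftPoly x ≠ shiftPoly y ∧
      ¬ f ∣ shiftPoly x := by
  simp [linkSet, and_assoc]

lemma shiftPoly_eq_mul_removeNth {n : ℕ} (x : Fin (n + 1) → ℤ) (i : Fin (n + 1)) :
    shiftPoly x = (X + C (x i)) * shiftPoly (i.removeNth x) := by
  rw [shiftPoly, Fin.prod_univ_succAbove _ i]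
  rfl

lemma card_linkSet_succ_le {f : ℤ[X]} (hf : Irreducible f) (n h : ℕ) :
    (linkSet f (n + 1) h).card ≤
      (freeSet f (n + 1) h).card + (n + 1) ^ 2 * (h * (linkSet f n h).card) := by
  classical
  have hcover : linkSet f (n + 1) h ⊆ freeSet f (n + 1) h ∪
      (Finset.univ : Finset (Fin (n + 1) × Fin (n + 1))).biUnion fun ij =>
        (linkSet f (n + 1) h).filter fun xy => xy.1 ij.1 = xy.2 ij.2 := by
    rintro ⟨x, y⟩ hxy
    have h1 := mem_linkSet.1 hxy
    rw [Finset.mem_union]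
    by_cases hfree : ∀ i j, x i ≠ y j
    · exact Or.inl (mem_freeSet.2 ⟨h1.1, h1.2.1, h1.2.2.1, hfree⟩)
    · push Not at hfree
      obtain ⟨i, j, hij⟩ := hfree
      exact Or.inr (Finset.mem_biUnion.2 ⟨(i, j), Finset.mem_univ _,
        Finset.mem_filter.2 ⟨hxy, hij⟩⟩)
  have hfib : ∀ ij : Fin (n + 1) × Fin (n + 1),
      ((linkSet f (n + 1) h).filter fun xy => xy.1 ij.1 = xy.2 ij.2).card ≤
        h * (linkSet f n h).card := by
    rintro ⟨i, j⟩
    have hc : (Finset.Icc 1 (h : ℤ) ×ˢ linkSet f n h).card = h * (linkSet f n h).card := by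
      rw [Finset.card_product]
      simp
    rw [← hc]
    apply Finset.card_le_card_of_injOn fun xy : (Fin (n + 1) → ℤ) × (Fin (n + 1) → ℤ) =>
      (xy.1 i, (i.removeNth xy.1, j.removeNth xy.2))
    · rintro ⟨x, y⟩ hxy
      obtain ⟨h1, h2⟩ := Finset.mem_filter.1 hxy
      dsimp only at h2
      obtain ⟨hx, hy, hdvd, hne, hnd⟩ := mem_linkSet.1 h1
      rw [shiftPoly_eq_mul_removeNth x i, shiftPoly_eq_mul_removeNth y j, ← h2] at hdvd hne
      rw [shiftPoly_eq_mul_removeNth x i] at hnd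
      rw [← mul_sub] at hdvd
      refine Finset.mem_product.2 ⟨Finset.mem_Icc.2 (mem_box.1 hx i), mem_linkSet.2
        ⟨mem_box.2 fun k => mem_box.1 hx _, mem_box.2 fun k => mem_box.1 hy _, ?_, ?_, ?_⟩⟩
      · exact (hf.prime.dvd_or_dvd hdvd).resolve_left fun h3 => hnd (h3.mul_right _)
      · exact fun h3 => hne (by rw [h3])
      · exact fun h3 => hnd (h3.mul_left _)
    · rintro ⟨x, y⟩ hxy ⟨x', y'⟩ hxy' heq
      have h2 := (Finset.mem_filter.1 hxy).2
      have h2' := (Finset.mem_filter.1 hxy').2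
      simp only [Prod.mk.injEq] at heq h2 h2'
      obtain ⟨e1, e2, e3⟩ := heq
      rw [Prod.mk.injEq, ← Fin.insertNth_self_removeNth i x, ← Fin.insertNth_self_removeNth j y,
        ← Fin.insertNth_self_removeNth i x', ← Fin.insertNth_self_removeNth j y', e2, e3, ← h2,
        ← h2', e1]
      exact ⟨rfl, rfl⟩
  refine (Finset.card_le_card hcover).trans ((Finset.card_union_le _ _).trans
    (Nat.add_le_add_left (Finset.card_biUnion_le.trans ((Finset.sum_le_sum fun ij _ =>
      hfib ij).trans (le_of_eq ?_))) _))
  simp [sq]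

/-- Unless `f` is linear with small coefficients, few pairs are linked through `f`. -/
lemma card_linkSet_le {f : ℤ[X]} {n ν h D : ℕ} {Δ H : ℝ} (hirr : Irreducible f)
    (hf : 1 ≤ f.natDegree) (hnν : n ≤ ν) (hh : 1 ≤ h)
    (hD : ∀ m : ℕ, m ≠ 0 → m ≤ h ^ (ν ^ 2) → m.divisors.card ≤ D)
    (hΔ : 1 ≤ Δ) (hΔh : Δ ≤ h) (hH1 : 1 ≤ H) (hH : (harmonic h : ℝ) ≤ H)
    (hbe : f.natDegree = 1 → Δ < |(f.coeff 1 : ℝ)| ∨ 2 * h * Δ < |(f.coeff 0 : ℝ)|) :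
    ((linkSet f n h).card : ℝ) ≤ (1 + ν ^ 2) ^ n *
      (4 * ν * (2 * ν) ^ ν * (3 * ν) ^ ν * (D : ℝ) ^ (2 * ν) * H * (h ^ n / Δ)) := by
  induction n with
  | zero =>
    have : linkSet f 0 h = ∅ := by
      refine Finset.eq_empty_of_forall_notMem fun ⟨x, y⟩ hxy => (mem_linkSet.1 hxy).2.2.2.1 ?_
      rw [Subsingleton.elim x y]
    rw [this, Finset.card_empty, Nat.cast_zero]
    positivity
  | succ n ih =>
    have h1 := card_freeSet_le hf (Nat.le_add_left 1 n) hnν hh hD hΔ hΔh hH1 hH hbe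
    have h2 := ih (by omega)
    set B : ℝ := 4 * ν * (2 * ν) ^ ν * (3 * ν) ^ ν * (D : ℝ) ^ (2 * ν) * H with hB
    have hB0 : 0 ≤ B := by positivity
    have h3 : ((n + 1 : ℕ) : ℝ) ≤ ν := by exact_mod_cast hnν
    have h4 : (1 : ℝ) ≤ (1 + ν ^ 2) ^ n := one_le_pow₀ (by nlinarith)
    calc ((linkSet f (n + 1) h).card : ℝ)
        ≤ (freeSet f (n + 1) h).card + ((n + 1 : ℕ) : ℝ) ^ 2 * (h * (linkSet f n h).card) := by
          exact_mod_cast card_linkSet_succ_le hirr n h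
      _ ≤ B * (h ^ (n + 1) / Δ) + ν ^ 2 * (h * ((1 + ν ^ 2) ^ n * (B * (h ^ n / Δ)))) := by
          gcongr
      _ = (1 + ν ^ 2 * (1 + ν ^ 2) ^ n) * (B * (h ^ (n + 1) / Δ)) := by ring
      _ ≤ ((1 + ν ^ 2) ^ n + ν ^ 2 * (1 + ν ^ 2) ^ n) * (B * (h ^ (n + 1) / Δ)) := by gcongr
      _ = _ := by ring

lemma one_lt_log_of_three_le {h : ℕ} (hh : 3 ≤ h) : 1 < Real.log h := by
  rw [Real.lt_log_iff_exp_lt (by positivity)]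
  have h3 : (3 : ℝ) ≤ h := by exact_mod_cast hh
  linarith [Real.exp_one_lt_three]

lemma one_le_log_div_log_log {h : ℕ} (hh : 3 ≤ h) : 1 ≤ Real.log h / Real.log (Real.log h) := by
  have h1 := one_lt_log_of_three_le hh
  rw [le_div_iff₀ (Real.log_pos h1), one_mul]
  exact Real.log_le_self (by linarith)

lemma le_exp_mul_log_div_log_log {c : ℝ} (hc : 0 ≤ c) {h : ℕ} (hh : 3 ≤ h) :
    c ≤ Real.exp (c * (Real.log h / Real.log (Real.log h))) := by
  have h1 := one_le_log_div_log_log hh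
  have h2 := Real.add_one_le_exp c
  calc c ≤ Real.exp c := by linarith
    _ ≤ _ := Real.exp_le_exp.2 (le_mul_of_one_le_right hc h1)

lemma one_add_log_le_exp {h : ℕ} (hh : 3 ≤ h) :
    1 + Real.log h ≤ Real.exp (8 * (Real.log h / Real.log (Real.log h))) := by
  have h1 := one_lt_log_of_three_le hh
  set L := Real.log h
  have hl : 0 < Real.log L := Real.log_pos h1
  rw [← Real.log_le_iff_le_exp (by linarith), ← mul_div_assoc, le_div_iff₀ hl]
  have e1 : Real.log L ≤ 2 * √L := by
    have := Real.log_le_rpow_div (x := L) (by linarith) (ε := 1 / 2) (by norm_num)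
    rw [← Real.sqrt_eq_rpow] at this
    linarith
  have e2 : Real.log (1 + L) ≤ 4 * √L := by
    have := Real.log_le_rpow_div (x := 1 + L) (by linarith) (ε := 1 / 2) (by norm_num)
    rw [← Real.sqrt_eq_rpow] at this
    have h2 : √(1 + L) ≤ 2 * √L := by
      rw [Real.sqrt_le_left (by positivity), mul_pow, Real.sq_sqrt (by linarith)]
      linarith
    linarith
  calc Real.log (1 + L) * Real.log L ≤ (4 * √L) * (2 * √L) := by gcongr
    _ = 8 * (√L * √L) := by ring
    _ = 8 * L := by rw [Real.mul_self_sqrt (by linarith)]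

lemma sum_factorization_mul_log {m : ℕ} (hm : m ≠ 0) :
    ∑ q ∈ m.primeFactors, (m.factorization q : ℝ) * Real.log q = Real.log m := by
  conv_rhs => rw [← Nat.prod_factorization_pow_eq_self hm, Finsupp.prod, Nat.support_factorization]
  push_cast
  rw [Real.log_prod]
  · exact Finset.sum_congr rfl fun q _ => (Real.log_pow _ _).symm
  · intro q hq
    have := (Nat.prime_of_mem_primeFactors hq).ne_zero
    positivity

/-- The classical bound for the number of divisors. -/
lemma card_divisors_le_exp {k h m : ℕ} (hh : 3 ≤ h) (hm : m ≠ 0) (hmh : m ≤ h ^ k) :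
    (m.divisors.card : ℝ) ≤
      Real.exp ((18 * (1 + 2 * k)) * (Real.log h / Real.log (Real.log h))) := by
  classical
  have h1 := one_lt_log_of_three_le hh
  set L := Real.log h with hL
  have hl : 0 < Real.log L := Real.log_pos h1
  have hL0 : 0 < L := by linarith
  set T := √L with hT
  have hT0 : 0 ≤ T := Real.sqrt_nonneg _
  have hlogT : Real.log T = Real.log L / 2 := Real.log_sqrt hL0.le
  have hmL : Real.log m ≤ k * L := by
    rw [hL, ← Real.log_pow]
    exact Real.log_le_log (by positivity) (by exact_mod_cast hmh)
  have hterm : ∀ q ∈ m.primeFactors, 0 ≤ (m.factorization q : ℝ) * Real.log q := fun q _ =>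
    mul_nonneg (by positivity) (Real.log_natCast_nonneg q)
  have hsum := (sum_factorization_mul_log hm).le.trans hmL
  have hcard : (m.divisors.card : ℝ) = ∏ q ∈ m.primeFactors, ((m.factorization q : ℝ) + 1) := by
    rw [Nat.card_divisors hm]
    push_cast
    rfl
  have hlarge : ∏ q ∈ m.primeFactors with T ≤ (q : ℕ), ((m.factorization q : ℝ) + 1) ≤
      Real.exp (2 * k * (L / Real.log L)) := by
    calc _ ≤ ∏ q ∈ m.primeFactors with T ≤ (q : ℕ), Real.exp (m.factorization q : ℝ) :=
          Finset.prod_le_prod (fun _ _ => by positivity) fun q _ => Real.add_one_le_exp _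
      _ = Real.exp (∑ q ∈ m.primeFactors with T ≤ (q : ℕ), (m.factorization q : ℝ)) :=
          (Real.exp_sum _ _).symm
      _ ≤ _ := by
          apply Real.exp_le_exp.2
          rw [← mul_div_assoc, le_div_iff₀ hl]
          have : (∑ q ∈ m.primeFactors with T ≤ (q : ℕ), (m.factorization q : ℝ)) * Real.log T ≤
              k * L := by
            rw [Finset.sum_mul]
            refine le_trans (Finset.sum_le_sum fun q hq => ?_)
              ((Finset.sum_le_sum_of_subset_of_nonneg (Finset.filter_subset (fun q : ℕ => T ≤ q) _)
                fun q hq _ => hterm q hq).trans hsum)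
            have := (Finset.mem_filter.1 hq).2
            have hTpos : 0 < T := Real.sqrt_pos.2 hL0
            gcongr
          rw [hlogT] at this
          linarith
  have hsmall : ∏ q ∈ m.primeFactors with ¬ T ≤ (q : ℕ), ((m.factorization q : ℝ) + 1) ≤
      Real.exp (16 * (1 + 2 * k) * (L / Real.log L)) := by
    have hle : ∀ q ∈ m.primeFactors, (m.factorization q : ℝ) + 1 ≤ (1 + 2 * k) * L := by
      intro q hq
      have hq2 : Real.log 2 ≤ Real.log q := Real.log_le_log (by norm_num)
        (by exact_mod_cast (Nat.prime_of_mem_primeFactors hq).two_le)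
      have e1 := (Finset.single_le_sum hterm hq).trans hsum
      have e2 : (m.factorization q : ℝ) * (1 / 2) ≤ m.factorization q * Real.log q := by
        gcongr
        linarith [Real.log_two_gt_d9]
      nlinarith
    have hge : 1 ≤ (1 + 2 * k) * L := by
      have : (0 : ℝ) ≤ k * L := by positivity
      linarith
    have hcardT : (({q ∈ m.primeFactors | ¬ T ≤ (q : ℕ)}.card : ℕ) : ℝ) ≤ T := by
      have : {q ∈ m.primeFactors | ¬ T ≤ (q : ℕ)} ⊆ Finset.Icc 1 ⌊T⌋₊ := by
        intro q hq
        obtain ⟨e1, e2⟩ := Finset.mem_filter.1 hq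
        exact Finset.mem_Icc.2 ⟨(Nat.prime_of_mem_primeFactors e1).one_le,
          Nat.le_floor (not_le.1 e2).le⟩
      have := Finset.card_le_card this
      rw [Nat.card_Icc, Nat.add_sub_cancel] at this
      exact (Nat.cast_le.2 this).trans (Nat.floor_le hT0)
    have hpos : 0 < (1 + 2 * k) * L := by positivity
    calc _ ≤ ∏ q ∈ m.primeFactors with ¬ T ≤ (q : ℕ), (1 + 2 * k) * L :=
          Finset.prod_le_prod (fun _ _ => by positivity)
            fun q hq => hle q (Finset.mem_filter.1 hq).1
      _ = Real.exp (({q ∈ m.primeFactors | ¬ T ≤ (q : ℕ)}.card : ℕ) *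
            Real.log ((1 + 2 * k) * L)) := by
          rw [Finset.prod_const, Real.exp_nat_mul, Real.exp_log hpos]
      _ ≤ _ := by
          apply Real.exp_le_exp.2
          rw [← mul_div_assoc, le_div_iff₀ hl]
          have q1 : Real.log L ≤ 4 * L ^ (1 / 4 : ℝ) := by
            have := Real.log_le_rpow_div (x := L) hL0.le (ε := 1 / 4) (by norm_num)
            linarith
          have q2 : Real.log ((1 + 2 * k) * L) ≤ 4 * ((1 + 2 * k) * L ^ (1 / 4 : ℝ)) := by
            have := Real.log_le_rpow_div (x := (1 + 2 * k) * L) hpos.le (ε := 1 / 4) (by norm_num)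
            rw [Real.mul_rpow (by positivity) hL0.le] at this
            have e3 : (1 + 2 * k : ℝ) ^ (1 / 4 : ℝ) ≤ 1 + 2 * k :=
              Real.rpow_le_self_of_one_le (by linarith [(Nat.cast_nonneg k : (0 : ℝ) ≤ k)])
                (by norm_num)
            have : (1 + 2 * k : ℝ) ^ (1 / 4 : ℝ) * L ^ (1 / 4 : ℝ) ≤
              (1 + 2 * k) * L ^ (1 / 4 : ℝ) := by gcongr
            linarith
          have q3 : L ^ (1 / 4 : ℝ) * L ^ (1 / 4 : ℝ) = T := by
            rw [← Real.rpow_add hL0, hT, Real.sqrt_eq_rpow]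
            norm_num
          have hlog0 : 0 ≤ Real.log ((1 + 2 * k) * L) := Real.log_nonneg hge
          calc _ ≤ T * (4 * ((1 + 2 * k) * L ^ (1 / 4 : ℝ))) * (4 * L ^ (1 / 4 : ℝ)) := by gcongr
            _ = 16 * (1 + 2 * k) * (T * (L ^ (1 / 4 : ℝ) * L ^ (1 / 4 : ℝ))) := by ring
            _ = _ := by rw [q3, hT, Real.mul_self_sqrt hL0.le]
  rw [hcard, ← Finset.prod_filter_mul_prod_filter_not _ (fun q : ℕ => T ≤ q)]
  calc _ ≤ Real.exp (2 * k * (L / Real.log L)) * Real.exp (16 * (1 + 2 * k) * (L / Real.log L)) :=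
        mul_le_mul hlarge hsmall (Finset.prod_nonneg fun _ _ => by positivity) (by positivity)
    _ ≤ _ := by
        rw [← Real.exp_add, ← add_mul]
        apply Real.exp_le_exp.2
        have : 0 ≤ L / Real.log L := by positivity
        have hk : (0 : ℝ) ≤ k := by positivity
        exact mul_le_mul_of_nonneg_right (by linarith) this

lemma exists_perm_of_shiftPoly_eq {n : ℕ} {x y : Fin n → ℤ} (hxy : shiftPoly x = shiftPoly y) :
    ∃ σ : Equiv.Perm (Fin n), y = x ∘ σ := by
  induction n with
  | zero => exact ⟨1, Subsingleton.elim _ _⟩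
  | succ n ih =>
    obtain ⟨i, hi⟩ : ∃ i, x i = y 0 := by
      have h1 := congrArg (fun q => q.eval (-y 0)) hxy
      simp only [eval_shiftPoly] at h1
      rw [Finset.prod_eq_zero (f := fun i => -y 0 + y i) (Finset.mem_univ 0) (by ring)] at h1
      obtain ⟨i, _, hi⟩ := Finset.prod_eq_zero_iff.1 h1
      exact ⟨i, by linarith⟩
    rw [shiftPoly_eq_mul_removeNth x i, shiftPoly_eq_mul_removeNth y 0, hi] at hxy
    obtain ⟨σ, hσ⟩ := ih (mul_left_cancel₀ (X_add_C_ne_zero _) hxy)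
    refine ⟨(finSuccEquiv' 0).trans ((Equiv.optionCongr σ).trans (finSuccEquiv' i).symm), ?_⟩
    funext j
    refine Fin.cases ?_ (fun j => ?_) j
    · simp [hi]
    · have h1 : finSuccEquiv' (0 : Fin (n + 1)) j.succ = some j := by
        rw [← Fin.succAbove_zero]
        exact finSuccEquiv'_succAbove _ _
      have := congrFun hσ j
      simpa [Fin.removeNth, h1] using this

lemma shiftPoly_comp_perm {n : ℕ} (x : Fin n → ℤ) (σ : Equiv.Perm (Fin n)) :
    shiftPoly (x ∘ σ) = shiftPoly x :=
  Equiv.prod_comp σ fun i => X + C (x i)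

open Classical in
/-- Pairs in the box with the same associated polynomial, which does not vanish at `s`. -/
noncomputable def diagonalSet {p : ℕ} (s : ZMod p) (n h : ℕ) :
    Finset ((Fin n → ℤ) × (Fin n → ℤ)) :=
  (box n h ×ˢ box n h).filter fun xy =>
    shiftPoly xy.1 = shiftPoly xy.2 ∧ aeval s (shiftPoly xy.1) ≠ 0

open Classical in
/-- Pairs in the box with different associated polynomials having the same nonzero value at `s`. -/
noncomputable def offDiagonalSet {p : ℕ} (s : ZMod p) (n h : ℕ) :
    Finset ((Fin n → ℤ) × (Fin n → ℤ)) :=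
  (box n h ×ˢ box n h).filter fun xy =>
    shiftPoly xy.1 ≠ shiftPoly xy.2 ∧ aeval s (shiftPoly xy.1) = aeval s (shiftPoly xy.2) ∧
      aeval s (shiftPoly xy.1) ≠ 0

lemma card_diagonalSet_le {p : ℕ} (s : ZMod p) (n h : ℕ) :
    (diagonalSet s n h).card ≤ n.factorial * h ^ n := by
  classical
  have hsub : diagonalSet s n h ⊆
      ((Finset.univ : Finset (Equiv.Perm (Fin n))) ×ˢ box n h).image
        fun σx => (σx.2, σx.2 ∘ σx.1) := by
    rintro ⟨x, y⟩ hxy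
    obtain ⟨h1, h2, _⟩ := Finset.mem_filter.1 hxy
    obtain ⟨σ, hσ⟩ := exists_perm_of_shiftPoly_eq h2
    exact Finset.mem_image.2 ⟨(σ, x), Finset.mem_product.2
      ⟨Finset.mem_univ _, (Finset.mem_product.1 h1).1⟩, Prod.ext rfl hσ.symm⟩
  refine (Finset.card_le_card hsub).trans (Finset.card_image_le.trans (le_of_eq ?_))
  rw [Finset.card_product, Finset.card_univ, Fintype.card_perm, Fintype.card_fin, box,
    Fintype.card_piFinset]
  simp

lemma le_card_diagonalSet {p : ℕ} [Fact p.Prime] (s : ZMod p) {n h : ℕ} (hp : h < p) :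
    n.factorial * (h - 1).descFactorial n ≤ (diagonalSet s n h).card := by
  classical
  set S : Finset ℤ := (Finset.Icc 1 (h : ℤ)).filter fun x => s + (x : ZMod p) ≠ 0 with hS
  have hScard : h - 1 ≤ S.card := by
    have h1 := Finset.card_filter_add_card_filter_not (s := Finset.Icc 1 (h : ℤ))
      fun x => s + (x : ZMod p) ≠ 0
    have h2 : ((Finset.Icc 1 (h : ℤ)).filter fun x : ℤ => ¬ s + (x : ZMod p) ≠ 0).card ≤ 1 := by
      rw [Finset.card_le_one]
      intro a ha b hb
      obtain ⟨ha1, ha2⟩ := Finset.mem_filter.1 ha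
      obtain ⟨hb1, hb2⟩ := Finset.mem_filter.1 hb
      rw [not_not] at ha2 hb2
      have h3 : (a : ZMod p) = b := add_left_cancel (ha2.trans hb2.symm)
      have h4 := (ZMod.intCast_eq_intCast_iff_dvd_sub a b p).1 h3
      rw [Finset.mem_Icc] at ha1 hb1
      have h5 := Int.eq_zero_of_abs_lt_dvd h4 (abs_lt.2 ⟨by omega, by omega⟩)
      omega
    rw [Int.card_Icc] at h1
    simp only [← hS] at h1
    omega
  have hcard : (Fintype.card (Equiv.Perm (Fin n) × (Fin n ↪ S))) ≤ (diagonalSet s n h).card := by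
    rw [← Finset.card_univ]
    apply Finset.card_le_card_of_injOn
      fun σx => ((fun i => (σx.2 i : ℤ)), (fun i => (σx.2 i : ℤ)) ∘ σx.1)
    · rintro ⟨σ, x⟩ _
      have hx : ∀ i, (x i : ℤ) ∈ Finset.Icc 1 (h : ℤ) ∧ s + ((x i : ℤ) : ZMod p) ≠ 0 := fun i =>
        Finset.mem_filter.1 (x i).2
      refine Finset.mem_filter.2 ⟨Finset.mem_product.2 ⟨mem_box.2 fun i =>
        Finset.mem_Icc.1 (hx i).1, mem_box.2 fun i => Finset.mem_Icc.1 (hx (σ i)).1⟩,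
        (shiftPoly_comp_perm _ σ).symm, ?_⟩
      rw [aeval_shiftPoly]
      exact Finset.prod_ne_zero_iff.2 fun i _ => (hx i).2
    · rintro ⟨σ, x⟩ _ ⟨τ, y⟩ _ hxy
      simp only [Prod.mk.injEq] at hxy
      obtain ⟨h1, h2⟩ := hxy
      have h3 : x = y := by
        ext i
        exact congrFun h1 i
      subst h3
      rw [Prod.mk.injEq]
      refine ⟨?_, rfl⟩
      ext i
      have := congrFun h2 i
      simp only [Function.comp_apply] at this
      rw [x.injective (Subtype.ext this)]
  rw [Fintype.card_prod, Fintype.card_perm, Fintype.card_fin, Fintype.card_embedding_eq,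
    Fintype.card_coe, Fintype.card_fin] at hcard
  refine le_trans ?_ hcard
  gcongr

lemma pow_sub_le_descFactorial_pred {n h : ℕ} (hn : 1 ≤ n) (hh : 1 ≤ h) :
    (h : ℝ) ^ n - n ^ 2 * (h : ℝ) ^ (n - 1) ≤ ((h - 1).descFactorial n : ℝ) := by
  have hh0 : (0 : ℝ) < h := by exact_mod_cast hh
  have e : (h : ℝ) ^ n = h ^ (n - 1) * h := by rw [← pow_succ, Nat.sub_add_cancel hn]
  rcases le_or_gt n h with hnh | hnh
  · have h1 := Nat.pow_sub_le_descFactorial (h - 1) n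
    rw [Nat.sub_add_cancel hh] at h1
    have h2 : ((h : ℝ) - n) ^ n ≤ ((h - 1).descFactorial n : ℝ) := by
      rw [← Nat.cast_sub hnh]
      exact_mod_cast h1
    refine le_trans ?_ h2
    have h3 : (n : ℝ) / h ≤ 1 := (div_le_one hh0).2 (by exact_mod_cast hnh)
    have h4 := one_add_mul_le_pow (a := -((n : ℝ) / h)) (by linarith) n
    have h5 : ((h : ℝ) - n) ^ n = h ^ n * (1 + -((n : ℝ) / h)) ^ n := by
      rw [← mul_pow]
      congr 1
      field_simp
      ring
    rw [h5]
    calc (h : ℝ) ^ n - n ^ 2 * (h : ℝ) ^ (n - 1) = h ^ n * (1 + n * -((n : ℝ) / h)) := by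
          rw [e]
          field_simp
          ring
      _ ≤ _ := by gcongr
  · have h1 : (h : ℝ) ≤ n := by exact_mod_cast hnh.le
    have h2 : (1 : ℝ) ≤ n := by exact_mod_cast hn
    have h3 : (h : ℝ) ^ n - n ^ 2 * (h : ℝ) ^ (n - 1) ≤ 0 := by
      rw [e]
      have h4 : 0 ≤ (h : ℝ) ^ (n - 1) := by positivity
      have h5 : (h : ℝ) ≤ n ^ 2 := by nlinarith
      linarith [mul_le_mul_of_nonneg_left h5 h4]
    exact h3.trans (by positivity)

/-- The deviation from the diagonal main term. -/
lemma abs_card_sub_le {p : ℕ} [Fact p.Prime] (s : ZMod p) {n h : ℕ} (hn : 1 ≤ n) (hh : 1 ≤ h)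
    (hp : h < p) :
    |((Set.ncard {xy : (Fin n → ℤ) × (Fin n → ℤ) |
            (∀ i, 1 ≤ xy.1 i ∧ xy.1 i ≤ (h : ℤ)) ∧
            (∀ i, 1 ≤ xy.2 i ∧ xy.2 i ≤ (h : ℤ)) ∧
            (∏ i, ((xy.1 i : ZMod p) + s)) = (∏ i, ((xy.2 i : ZMod p) + s)) ∧
            (∏ i, ((xy.1 i : ZMod p) + s)) ≠ 0} : ℕ) : ℝ) -
          (Nat.factorial n : ℝ) * (h : ℝ) ^ n| ≤
      n.factorial * n ^ 2 * (h : ℝ) ^ (n - 1) + (offDiagonalSet s n h).card := by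
  classical
  have hset : {xy : (Fin n → ℤ) × (Fin n → ℤ) |
            (∀ i, 1 ≤ xy.1 i ∧ xy.1 i ≤ (h : ℤ)) ∧
            (∀ i, 1 ≤ xy.2 i ∧ xy.2 i ≤ (h : ℤ)) ∧
            (∏ i, ((xy.1 i : ZMod p) + s)) = (∏ i, ((xy.2 i : ZMod p) + s)) ∧
            (∏ i, ((xy.1 i : ZMod p) + s)) ≠ 0} =
      ((diagonalSet s n h ∪ offDiagonalSet s n h : Finset _) :
        Set ((Fin n → ℤ) × (Fin n → ℤ))) := by
    ext ⟨x, y⟩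
    simp only [Set.mem_ofPred_eq, Finset.coe_union, Set.mem_union, Finset.mem_coe, diagonalSet,
      offDiagonalSet, Finset.mem_filter, Finset.mem_product, mem_box, aeval_shiftPoly,
      add_comm _ s]
    constructor
    · rintro ⟨hx, hy, h1, h2⟩
      by_cases hxy : shiftPoly x = shiftPoly y
      · exact Or.inl ⟨⟨hx, hy⟩, hxy, h2⟩
      · exact Or.inr ⟨⟨hx, hy⟩, hxy, h1, h2⟩
    · rintro (⟨⟨hx, hy⟩, hxy, h2⟩ | ⟨⟨hx, hy⟩, hxy, h1, h2⟩)
      · refine ⟨hx, hy, ?_, h2⟩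
        rw [← aeval_shiftPoly, ← aeval_shiftPoly, hxy]
      · exact ⟨hx, hy, h1, h2⟩
  have hdisj : Disjoint (diagonalSet s n h) (offDiagonalSet s n h) := by
    rw [Finset.disjoint_left]
    intro xy h1 h2
    exact (Finset.mem_filter.1 h2).2.1 (Finset.mem_filter.1 h1).2.1
  rw [hset, Set.ncard_coe_finset, Finset.card_union_of_disjoint hdisj]
  have h1 : ((diagonalSet s n h).card : ℝ) ≤ n.factorial * (h : ℝ) ^ n := by
    exact_mod_cast card_diagonalSet_le s n h
  have h2 : (n.factorial : ℝ) * ((h - 1).descFactorial n : ℝ) ≤ (diagonalSet s n h).card := by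
    exact_mod_cast le_card_diagonalSet s hp
  have h3 := mul_le_mul_of_nonneg_left (pow_sub_le_descFactorial_pred hn hh)
    (Nat.cast_nonneg (α := ℝ) n.factorial)
  have h4 : (0 : ℝ) ≤ (offDiagonalSet s n h).card := by positivity
  have h5 : (0 : ℝ) ≤ n.factorial * n ^ 2 * (h : ℝ) ^ (n - 1) := by positivity
  push_cast
  rw [abs_le]
  constructor <;> linarith

/-- If there are many off-diagonal solutions then the shift satisfies a linear congruence with
small coefficients. -/
lemma card_offDiagonalSet_le_or {ν h p D : ℕ} {Δ H : ℝ} (hν : 2 ≤ ν) (hh : 1 ≤ h) (hp : p.Prime)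
    (hlt : (ν * 4 ^ ν * h ^ (ν + 1)) ^ (ν - 1) < p) (s : ZMod p)
    (hD : ∀ m : ℕ, m ≠ 0 → m ≤ h ^ (ν ^ 2) → m.divisors.card ≤ D)
    (hΔ : 1 ≤ Δ) (hΔh : Δ ≤ h) (hH1 : 1 ≤ H) (hH : (harmonic h : ℝ) ≤ H) :
    ((offDiagonalSet s ν h).card : ℝ) ≤ (1 + ν ^ 2) ^ ν *
      (4 * ν * (2 * ν) ^ ν * (3 * ν) ^ ν * (D : ℝ) ^ (2 * ν) * H * (h ^ ν / Δ)) ∨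
    ∃ b e : ℤ, b ≠ 0 ∧ |(b : ℝ)| ≤ Δ ∧ |(e : ℝ)| ≤ 2 * h * Δ ∧ (b : ZMod p) * s + e = 0 := by
  rcases (offDiagonalSet s ν h).eq_empty_or_nonempty with hemp | ⟨⟨x₀, y₀⟩, h₀⟩
  · left
    rw [hemp, Finset.card_empty, Nat.cast_zero]
    positivity
  obtain ⟨h1, h2, h3, h4⟩ := Finset.mem_filter.1 h₀
  obtain ⟨h5, h6⟩ := Finset.mem_product.1 h1
  obtain ⟨f, hirr, hf, hfs, hall⟩ := exists_irreducible_common_factor hν hh hp hlt s h5 h6 h2 h3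
  by_cases hbe : f.natDegree = 1 → Δ < |(f.coeff 1 : ℝ)| ∨ 2 * h * Δ < |(f.coeff 0 : ℝ)|
  · left
    refine le_trans ?_ (card_linkSet_le hirr hf le_rfl hh hD hΔ hΔh hH1 hH hbe)
    rw [Nat.cast_le]
    apply Finset.card_le_card
    rintro ⟨x, y⟩ hxy
    obtain ⟨g1, g2, g3, g4⟩ := Finset.mem_filter.1 hxy
    obtain ⟨g5, g6⟩ := Finset.mem_product.1 g1
    refine mem_linkSet.2 ⟨g5, g6, hall x g5 y g6 g3, g2, fun ⟨q, hq⟩ => g4 ?_⟩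
    dsimp only
    rw [hq, map_mul, hfs, zero_mul]
  · right
    push Not at hbe
    obtain ⟨hf1, hb, he⟩ := hbe
    refine ⟨f.coeff 1, f.coeff 0, ?_, hb, he, ?_⟩
    · rw [← hf1]
      exact leadingCoeff_ne_zero.2 hirr.ne_zero
    · rw [eq_X_add_C_of_natDegree_le_one hf1.le] at hfs
      simpa using hfs

/-- Few residues satisfy a linear congruence with small coefficients. -/
lemma ncard_linear_congruence_le {p h : ℕ} [Fact p.Prime] {Δ : ℝ} (hh : h < p) (hΔ : 1 ≤ Δ)
    (hΔh : Δ ≤ h) :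
    (Set.ncard {s : ZMod p | ∃ b e : ℤ, b ≠ 0 ∧ |(b : ℝ)| ≤ Δ ∧ |(e : ℝ)| ≤ 2 * h * Δ ∧
      (b : ZMod p) * s + e = 0} : ℝ) ≤ 15 * (h * Δ ^ 2) := by
  classical
  set S := {s : ZMod p | ∃ b e : ℤ, b ≠ 0 ∧ |(b : ℝ)| ≤ Δ ∧ |(e : ℝ)| ≤ 2 * h * Δ ∧
      (b : ZMod p) * s + e = 0} with hS
  have hhR : (1 : ℝ) ≤ h := hΔ.trans hΔh
  set R : Finset (ℤ × ℤ) := Finset.Icc (-⌊Δ⌋) ⌊Δ⌋ ×ˢ Finset.Icc (-⌊2 * h * Δ⌋) ⌊2 * h * Δ⌋ with hR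
  have hsub : S ⊆ ((R.image fun be => -((be.2 : ZMod p) / be.1) : Finset (ZMod p)) :
      Set (ZMod p)) := by
    rintro s ⟨b, e, hb0, hb, he, hs⟩
    rw [Finset.mem_coe, Finset.mem_image]
    rw [abs_le] at hb he
    refine ⟨(b, e), Finset.mem_product.2 ⟨Finset.mem_Icc.2 ⟨?_, Int.le_floor.2 hb.2⟩,
      Finset.mem_Icc.2 ⟨?_, Int.le_floor.2 he.2⟩⟩, ?_⟩
    · rw [neg_le, Int.le_floor]
      push_cast
      linarith
    · rw [neg_le, Int.le_floor]
      push_cast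
      linarith
    · have hbp : (b : ZMod p) ≠ 0 := by
        intro h0
        rw [ZMod.intCast_zmod_eq_zero_iff_dvd] at h0
        refine hb0 (Int.eq_zero_of_abs_lt_dvd h0 ?_)
        have : ((|b| : ℤ) : ℝ) < (p : ℤ) := by
          rw [Int.cast_abs]
          refine lt_of_le_of_lt ((abs_le.2 hb).trans hΔh) ?_
          exact_mod_cast hh
        exact_mod_cast this
      dsimp only
      rw [neg_eq_iff_eq_neg, div_eq_iff hbp]
      linear_combination hs
  have h1 : (S.ncard : ℝ) ≤ R.card := by
    have := Set.ncard_le_ncard hsub (Finset.finite_toSet _)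
    rw [Set.ncard_coe_finset] at this
    exact_mod_cast this.trans Finset.card_image_le
  have hcard : ∀ x : ℝ, 0 ≤ x → ((Finset.Icc (-⌊x⌋) ⌊x⌋).card : ℝ) ≤ 2 * x + 1 := by
    intro x hx
    have h0 : 0 ≤ ⌊x⌋ := Int.floor_nonneg.2 hx
    have h2 : ((Finset.Icc (-⌊x⌋) ⌊x⌋).card : ℤ) = 2 * ⌊x⌋ + 1 := by
      rw [Int.card_Icc]
      omega
    have h3 : ((Finset.Icc (-⌊x⌋) ⌊x⌋).card : ℝ) = 2 * ⌊x⌋ + 1 := by exact_mod_cast h2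
    rw [h3]
    linarith [Int.floor_le x]
  have hhΔ : 1 ≤ h * Δ := by nlinarith
  calc (S.ncard : ℝ) ≤ R.card := h1
    _ ≤ (2 * Δ + 1) * (2 * (2 * h * Δ) + 1) := by
        rw [hR, Finset.card_product]
        push_cast
        exact mul_le_mul (hcard _ (by linarith)) (hcard _ (by positivity)) (by positivity)
          (by positivity)
    _ ≤ (3 * Δ) * (5 * (h * Δ)) := by gcongr <;> linarith
    _ = _ := by ring

lemma pow_lt_of_le_mul_rpow {ν p h : ℕ} (hν : 2 ≤ ν) (hp : p.Prime)
    (hhp : (h : ℝ) ≤ 1 / (2 * (ν * 4 ^ ν) ^ (ν - 1)) *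
      (p : ℝ) ^ ((1 : ℝ) / ((ν : ℝ) ^ 2 - 1))) :
    (ν * 4 ^ ν * h ^ (ν + 1)) ^ (ν - 1) < p := by
  set N := (ν + 1) * (ν - 1) with hN
  have hN0 : N ≠ 0 := by
    rw [hN]
    exact Nat.mul_ne_zero (by omega) (by omega)
  have hNR : (N : ℝ) = (ν : ℝ) ^ 2 - 1 := by
    rw [hN, Nat.cast_mul, Nat.cast_sub (by omega)]
    push_cast
    ring
  set c : ℝ := (ν * 4 ^ ν) ^ (ν - 1) with hc
  have hνR : (1 : ℝ) ≤ ν := by exact_mod_cast (by omega : 1 ≤ ν)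
  have hc1 : 1 ≤ c := by
    apply one_le_pow₀
    have : (1 : ℝ) ≤ 4 ^ ν := one_le_pow₀ (by norm_num)
    nlinarith
  have hp0 : (0 : ℝ) < p := by exact_mod_cast hp.pos
  have h1 : (h : ℝ) ^ N ≤ (1 / (2 * c)) * p := by
    calc (h : ℝ) ^ N ≤ (1 / (2 * c) * (p : ℝ) ^ ((1 : ℝ) / ((ν : ℝ) ^ 2 - 1))) ^ N := by gcongr
      _ = (1 / (2 * c)) ^ N * p := by
          rw [mul_pow, ← hNR, one_div (N : ℝ), Real.rpow_inv_natCast_pow hp0.le hN0]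
      _ ≤ (1 / (2 * c)) * p := by
          gcongr
          refine pow_le_of_le_one (by positivity) ?_ hN0
          rw [div_le_one (by positivity)]
          linarith
  have h2 : ((ν * 4 ^ ν * h ^ (ν + 1) : ℕ) : ℝ) ^ (ν - 1) = c * (h : ℝ) ^ N := by
    push_cast
    rw [mul_pow, ← pow_mul]
  have h3 : ((ν * 4 ^ ν * h ^ (ν + 1) : ℕ) : ℝ) ^ (ν - 1) < p := by
    rw [h2]
    calc c * (h : ℝ) ^ N ≤ c * ((1 / (2 * c)) * p) := by gcongr
      _ = p / 2 := by field_simp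
      _ < p := by linarith
  exact_mod_cast h3

lemma lt_of_pow_lt {ν p h : ℕ} (hν : 2 ≤ ν) (hlt : (ν * 4 ^ ν * h ^ (ν + 1)) ^ (ν - 1) < p) :
    h < p := by
  refine lt_of_le_of_lt ?_ hlt
  calc h ≤ h ^ (ν + 1) := Nat.le_self_pow (by omega) h
    _ ≤ ν * 4 ^ ν * h ^ (ν + 1) := Nat.le_mul_of_pos_left _ (by positivity)
    _ ≤ _ := Nat.le_self_pow (by omega) _

/-- If no linear congruence with small coefficients holds, the deviation is small. -/
lemma deviation_le {ν h D : ℕ} {ε : ℝ} (hν : 2 ≤ ν) (hε2 : ε ≤ 2) (hh : 3 ≤ h)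
    (hD : (D : ℝ) ≤
      Real.exp ((18 * (1 + 2 * (ν ^ 2 : ℕ))) * (Real.log h / Real.log (Real.log h)))) :
    ν.factorial * ν ^ 2 * (h : ℝ) ^ (ν - 1) + (1 + ν ^ 2) ^ ν *
      (4 * ν * (2 * ν) ^ ν * (3 * ν) ^ ν * (D : ℝ) ^ (2 * ν) * (1 + Real.log h) *
        (h ^ ν / (h : ℝ) ^ (ε / 2))) ≤
    (h : ℝ) ^ ((ν : ℝ) - ε / 2) *
      Real.exp ((ν.factorial * ν ^ 2 + (1 + ν ^ 2) ^ ν * (4 * ν * (2 * ν) ^ ν * (3 * ν) ^ ν) +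
        (2 * ν : ℕ) * (18 * (1 + 2 * (ν ^ 2 : ℕ))) + 8) *
          Real.log h / Real.log (Real.log h)) := by
  have hhR : (1 : ℝ) ≤ h := by exact_mod_cast (by omega : 1 ≤ h)
  have hh0 : (0 : ℝ) < h := by linarith
  have hE := one_le_log_div_log_log hh
  have hlog0 : 0 ≤ Real.log h := Real.log_natCast_nonneg h
  rw [mul_div_assoc]
  set E := Real.log h / Real.log (Real.log h)
  set a : ℝ := ν.factorial * ν ^ 2 with ha
  set b : ℝ := (1 + ν ^ 2) ^ ν * (4 * ν * (2 * ν) ^ ν * (3 * ν) ^ ν) with hb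
  set c : ℝ := 18 * (1 + 2 * (ν ^ 2 : ℕ)) with hc
  have ha0 : 0 ≤ a := by positivity
  have hb0 : 0 ≤ b := by positivity
  have hc0 : 0 ≤ c := by positivity
  set P := (h : ℝ) ^ ((ν : ℝ) - ε / 2) with hP
  have hP0 : 0 ≤ P := by positivity
  have e1 : (h : ℝ) ^ ν / (h : ℝ) ^ (ε / 2) = P := by
    rw [hP, Real.rpow_sub hh0, Real.rpow_natCast]
  have e2 : (h : ℝ) ^ (ν - 1) ≤ P := by
    rw [hP, ← Real.rpow_natCast, Nat.cast_sub (by omega)]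
    apply Real.rpow_le_rpow_of_exponent_le hhR
    push_cast
    linarith
  have e3 : (D : ℝ) ^ (2 * ν) ≤ Real.exp (((2 * ν : ℕ) : ℝ) * c * E) := by
    rw [mul_assoc, Real.exp_nat_mul]
    gcongr
  have e4 := one_add_log_le_exp hh
  have e5 := le_exp_mul_log_div_log_log (add_nonneg ha0 hb0) hh
  have e6 : 1 ≤ Real.exp (((2 * ν : ℕ) : ℝ) * c * E) * Real.exp (8 * E) := by
    rw [← Real.exp_add]
    apply Real.one_le_exp
    positivity
  rw [e1]
  calc a * (h : ℝ) ^ (ν - 1) + (1 + ν ^ 2) ^ ν *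
        (4 * ν * (2 * ν) ^ ν * (3 * ν) ^ ν * (D : ℝ) ^ (2 * ν) * (1 + Real.log h) * P)
      = a * (h : ℝ) ^ (ν - 1) * 1 + b * ((D : ℝ) ^ (2 * ν) * (1 + Real.log h)) * P := by
        rw [hb]; ring
    _ ≤ a * P * (Real.exp (((2 * ν : ℕ) : ℝ) * c * E) * Real.exp (8 * E)) +
        b * (Real.exp (((2 * ν : ℕ) : ℝ) * c * E) * Real.exp (8 * E)) * P := by
        gcongr
    _ = P * ((a + b) * (Real.exp (((2 * ν : ℕ) : ℝ) * c * E) * Real.exp (8 * E))) := by ring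
    _ ≤ P * (Real.exp ((a + b) * E) *
        (Real.exp (((2 * ν : ℕ) : ℝ) * c * E) * Real.exp (8 * E))) := by gcongr
    _ = _ := by
        rw [← Real.exp_add, ← Real.exp_add]
        ring_nf

end ShiftedProducts

/-- For fixed `ν ≥ 2` and `0 < ε ≤ 2` there are `γ, C₁, C₂ > 0` such that for every
prime `p` and every integer `3 ≤ h ≤ γ·p^{1/(ν²−1)}`, the number of `s ∈ 𝔽_p` with
`|K_ν(p,h,s) − ν!·h^ν| > h^{ν−ε/2} exp(C₁ log h / log log h)` is at most `C₂·h^{1+ε}`. -/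
theorem stmt8 (ν : ℕ) (hν : 2 ≤ ν) (ε : ℝ) (hε : 0 < ε) (hε2 : ε ≤ 2) :
    ∃ γ C₁ C₂ : ℝ, 0 < γ ∧ 0 < C₁ ∧ 0 < C₂ ∧ ∀ p : ℕ, p.Prime → ∀ h : ℕ, 3 ≤ h →
      (h : ℝ) ≤ γ * (p : ℝ) ^ ((1 : ℝ) / ((ν : ℝ) ^ 2 - 1)) →
      (Set.ncard {s : ZMod p |
        |(Set.ncard {xy : (Fin ν → ℤ) × (Fin ν → ℤ) |
            (∀ i, 1 ≤ xy.1 i ∧ xy.1 i ≤ (h : ℤ)) ∧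
            (∀ i, 1 ≤ xy.2 i ∧ xy.2 i ≤ (h : ℤ)) ∧
            (∏ i, ((xy.1 i : ZMod p) + s)) = (∏ i, ((xy.2 i : ZMod p) + s)) ∧
            (∏ i, ((xy.1 i : ZMod p) + s)) ≠ 0} : ℝ) -
          (Nat.factorial ν : ℝ) * (h : ℝ) ^ ν| >
          (h : ℝ) ^ ((ν : ℝ) - ε / 2) *
            Real.exp (C₁ * Real.log h / Real.log (Real.log h))} : ℝ)
        ≤ C₂ * (h : ℝ) ^ ((1 : ℝ) + ε) := by
  set c₀ : ℝ := ν.factorial * ν ^ 2 + (1 + ν ^ 2) ^ ν * (4 * ν * (2 * ν) ^ ν * (3 * ν) ^ ν) +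
        (2 * ν : ℕ) * (18 * (1 + 2 * (ν ^ 2 : ℕ))) + 8 with hc₀
  refine ⟨1 / (2 * (ν * 4 ^ ν) ^ (ν - 1)), c₀, 15, by positivity, by positivity, by norm_num, ?_⟩
  intro p hp h hh hhp
  have := Fact.mk hp
  have hlt := ShiftedProducts.pow_lt_of_le_mul_rpow hν hp hhp
  have hhlt := ShiftedProducts.lt_of_pow_lt hν hlt
  have hhR : (1 : ℝ) ≤ h := by exact_mod_cast (by omega : 1 ≤ h)
  have hh0 : (0 : ℝ) < h := by linarith
  have hΔ : 1 ≤ (h : ℝ) ^ (ε / 2) := Real.one_le_rpow hhR (by linarith)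
  have hΔh : (h : ℝ) ^ (ε / 2) ≤ h := by
    calc (h : ℝ) ^ (ε / 2) ≤ (h : ℝ) ^ (1 : ℝ) :=
          Real.rpow_le_rpow_of_exponent_le hhR (by linarith)
      _ = h := Real.rpow_one _
  set D := ⌊Real.exp ((18 * (1 + 2 * (ν ^ 2 : ℕ))) *
    (Real.log h / Real.log (Real.log h)))⌋₊ with hDdef
  have hD : ∀ m : ℕ, m ≠ 0 → m ≤ h ^ (ν ^ 2) → m.divisors.card ≤ D := fun m hm hm' =>
    Nat.le_floor (ShiftedProducts.card_divisors_le_exp hh hm hm')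
  have hDle := Nat.floor_le (Real.exp_nonneg ((18 * (1 + 2 * (ν ^ 2 : ℕ))) *
    (Real.log h / Real.log (Real.log h))))
  have hpow : (h : ℝ) * ((h : ℝ) ^ (ε / 2)) ^ 2 = (h : ℝ) ^ (1 + ε) := by
    rw [Real.rpow_add hh0, Real.rpow_one, ← Real.rpow_natCast, ← Real.rpow_mul hh0.le]
    norm_num
  rw [← hpow]
  refine le_trans ?_ (ShiftedProducts.ncard_linear_congruence_le hhlt hΔ hΔh)
  rw [Nat.cast_le]
  refine Set.ncard_le_ncard (fun s hs => ?_) (Set.toFinite _)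
  refine (ShiftedProducts.card_offDiagonalSet_le_or hν (by omega) hp hlt s hD hΔ hΔh
    (H := 1 + Real.log h) (by linarith [Real.log_natCast_nonneg h])
    (harmonic_le_one_add_log h)).resolve_left fun hcon => ?_
  rw [Set.mem_ofPred_eq] at hs
  refine absurd hs (not_lt.2 ?_)
  exact (ShiftedProducts.abs_card_sub_le s (by omega) (by omega) hhlt).trans
    ((add_le_add le_rfl hcon).trans (ShiftedProducts.deviation_le hν hε2 hh hDle))
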